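/- arXiv:2202.01262 — 10 statements merged into one kernel-verified Lean document; each statement's English description precedes it below -/
import Mathlib

section
/- Let w : ℝ → ℝ be twice continuously differentiable with w, w′ and w″ all integrable on ℝ, and let h > 0. Then the infinite trapezoidal sum converges and the quadrature error satisfies |∫_ℝ w(x) dx − Σ_{i∈ℤ} h·w(ih)| ≤ h² · ∫_ℝ |w″(x)| dx. -/
open MeasureTheory

lemma aux_hasSum (f : ℝ → ℝ) (hf : Integrable f) (h : ℝ) (hh : 0 < h) :
    HasSum (fun i : ℤ => ∫ x in (i * h)..(i * h + h), f x) (∫ x, f x) := by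
  have hU : (⋃ n : ℤ, Set.Ioc ((n : ℝ) * h) (n * h + h)) = Set.univ := by
    have := iUnion_Ioc_zsmul (α := ℝ) hh
    rw [← this]
    refine Set.iUnion_congr fun n => ?_
    simp only [zsmul_eq_mul]; push_cast; rw [add_mul, one_mul]
  have hd : Pairwise (Function.onFun Disjoint
      (fun n : ℤ => Set.Ioc ((n : ℝ) * h) (n * h + h))) := by
    have := Set.pairwise_disjoint_Ioc_zsmul h
    simp only [zsmul_eq_mul] at this
    push_cast at this
    simpa only [add_mul, one_mul] using this
  have := hasSum_integral_iUnion (μ := volume) (f := f)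
    (fun n : ℤ => measurableSet_Ioc (a := (n : ℝ) * h) (b := n * h + h)) hd hf.integrableOn
  rw [hU, setIntegral_univ] at this
  have e : (fun i : ℤ => ∫ x in (i * h)..(i * h + h), f x)
      = fun i : ℤ => ∫ x in Set.Ioc ((i : ℝ) * h) (i * h + h), f x := by
    funext i
    rw [intervalIntegral.integral_of_le (by linarith)]
  rw [e]
  exact this

lemma aux_bound (k g : ℝ → ℝ) (C a b : ℝ) (hab : a ≤ b) (hg : Continuous g) (hk : Continuous k)
    (hC : ∀ x ∈ Set.Icc a b, |k x| ≤ C) :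
    |∫ x in a..b, k x * g x| ≤ C * ∫ x in a..b, |g x| := by
  refine (intervalIntegral.abs_integral_le_integral_abs hab).trans ?_
  rw [← intervalIntegral.integral_const_mul]
  refine intervalIntegral.integral_mono_on hab
    ((hk.mul hg).abs.intervalIntegrable _ _) ((continuous_const.mul hg.abs).intervalIntegrable _ _) ?_
  intro x hx
  rw [abs_mul]
  exact mul_le_mul_of_nonneg_right (hC x hx) (abs_nonneg _)

lemma aux_ftc1 (w w' : ℝ → ℝ) (h1 : ∀ x, HasDerivAt w (w' x) x) (hc0 : Continuous w)
    (hc : Continuous w') (a h : ℝ) :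
    h * w a = (∫ x in a..(a + h), w x) + ∫ x in a..(a + h), (x - (a + h)) * w' x := by
  rw [← intervalIntegral.integral_add (hc0.intervalIntegrable _ _)
    (Continuous.intervalIntegrable (by fun_prop) _ _)]
  rw [intervalIntegral.integral_eq_sub_of_hasDerivAt (f := fun x => (x - (a + h)) * w x)]
  · ring
  · intro x _
    convert ((hasDerivAt_id x).sub_const (a + h)).mul (h1 x) using 1
    · rfl
    · rfl
    · simp only [id]; ring
  · exact Continuous.intervalIntegrable (by fun_prop) _ _

lemma aux_ftc2 (w w' w'' : ℝ → ℝ) (h1 : ∀ x, HasDerivAt w (w' x) x)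
    (h2 : ∀ x, HasDerivAt w' (w'' x) x) (hc0 : Continuous w)
    (hc : Continuous w'') (a h : ℝ) :
    (∫ x in a..(a + h), w x) - (h * w a + h * w (a + h)) / 2
      = ∫ x in a..(a + h), ((x - a) * (x - (a + h)) / 2) * w'' x := by
  rw [← sub_eq_zero, sub_right_comm, ← intervalIntegral.integral_sub (hc0.intervalIntegrable _ _)
    (Continuous.intervalIntegrable (by fun_prop) _ _)]
  rw [intervalIntegral.integral_eq_sub_of_hasDerivAt
    (f := fun x => (x - (a + h / 2)) * w x - ((x - a) * (x - (a + h)) / 2) * w' x)]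
  · ring
  · intro x _
    have e := hasDerivAt_id x
    convert ((e.sub_const (a + h / 2)).mul (h1 x)).sub
      ((((e.sub_const a).mul (e.sub_const (a + h))).div_const 2).mul (h2 x)) using 1
    · funext y
      simp only [id, Pi.mul_apply, Pi.sub_apply]
    · simp only [id, Pi.mul_apply]; ring
  · exact Continuous.intervalIntegrable (by fun_prop) _ _

/-- **Trapezoidal quadrature error on the infinite uniform grid** (Lemma 2.2, regular case).
If `w` is twice continuously differentiable with `w`, `w'`, `w''` integrable on `ℝ`, and `h > 0`,
then the infinite trapezoidal sum `Σ_{i∈ℤ} h·w(ih)` converges and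
`|∫ w − Σ h·w(ih)| ≤ h² ∫ |w''|`. -/
theorem trapezoidal_quadrature_error
    (w : ℝ → ℝ) (h : ℝ)
    (hw : ContDiff ℝ 2 w)
    (hw0 : Integrable w)
    (hw1 : Integrable (deriv w))
    (hw2 : Integrable (deriv (deriv w)))
    (hh : 0 < h) :
    Summable (fun i : ℤ => h * w (i * h)) ∧
    |(∫ x : ℝ, w x) - ∑' i : ℤ, h * w (i * h)| ≤ h ^ 2 * ∫ x : ℝ, |deriv (deriv w) x| := by
  have hw' : ContDiff ℝ 1 (deriv w) := by
    have : ContDiff ℝ (1 + 1) w := by simpa [one_add_one_eq_two] using hw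
    exact (contDiff_succ_iff_deriv.1 this).2.2
  have c0 : Continuous w := hw.continuous
  have c1 : Continuous (deriv w) := hw'.continuous
  have c2 : Continuous (deriv (deriv w)) := hw'.continuous_deriv le_rfl
  have h1 : ∀ x, HasDerivAt w (deriv w x) x := fun x =>
    (hw.differentiable (by norm_num) x).hasDerivAt
  have h2 : ∀ x, HasDerivAt (deriv w) (deriv (deriv w) x) x := fun x =>
    (hw'.differentiable (by norm_num) x).hasDerivAt
  have S0 := aux_hasSum w hw0 h hh
  have S1 := aux_hasSum _ hw1.abs h hh
  have S2 := aux_hasSum _ hw2.abs h hh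
  have hS : Summable (fun i : ℤ => h * w (i * h)) := by
    have : Summable (fun i : ℤ => ∫ x in (i * h)..(i * h + h), (x - (i * h + h)) * deriv w x) := by
      refine Summable.of_norm_bounded (S1.mul_left h).summable fun i => ?_
      refine aux_bound _ _ _ _ _ (by linarith) c1 (by fun_prop) fun x hx => ?_
      rw [abs_le]; constructor <;> linarith [hx.1, hx.2]
    refine (S0.summable.add this).congr fun i => ?_
    exact (aux_ftc1 w _ h1 c0 c1 _ _).symm
  refine ⟨hS, ?_⟩
  have T := hS.hasSum
  have T' : HasSum (fun i : ℤ => h * w (i * h + h)) (∑' i : ℤ, h * w (i * h)) := by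
    have := (Equiv.addRight (1 : ℤ)).hasSum_iff.2 T
    convert this using 2 with i
    simp [add_mul]
  have E := S0.sub ((T.add T').div_const 2)
  rw [add_self_div_two] at E
  rw [← E.tsum_eq, ← Real.norm_eq_abs]
  refine tsum_of_norm_bounded (S2.mul_left (h ^ 2)) fun i => ?_
  rw [aux_ftc2 w _ _ h1 h2 c0 c2]
  refine aux_bound _ _ _ _ _ (by linarith) c2 (by fun_prop) fun x hx => ?_
  obtain ⟨ha, hb⟩ := hx
  rw [abs_le]; constructor <;> nlinarith [mul_nonneg (sub_nonneg.2 ha) (sub_nonneg.2 hb), sq_nonneg h]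
end

section
/- Let w : ℝ → ℝ be twice continuously differentiable with w, w′ and w″ all integrable on ℝ, and let h > 0. Then the restriction of w to the grid lies in the weighted space ℓ¹_h, i.e. the sum Σ_{i∈ℤ} h·|w(ih)| converges, and Σ_{i∈ℤ} h·|w(ih)| ≤ ∫_ℝ |w(x)| dx + h² · ∫_ℝ |w″(x)| dx. -/
open MeasureTheory

lemma cell_bound (w : ℝ → ℝ) (h x : ℝ) (hw : ContDiff ℝ 2 w) (hh : 0 < h) :
    h * |w x| ≤ (∫ y in (x - h/2)..(x + h/2), |w y|)
      + h ^ 2 * ∫ y in (x - h/2)..(x + h/2), |deriv (deriv w) y| := by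
  have hw' : ContDiff ℝ 1 (deriv w) := by
    have : ContDiff ℝ (1 + 1) w := by
      have e : (1 + 1 : WithTop ℕ∞) = 2 := by norm_num
      rw [e]; exact hw
    exact (contDiff_succ_iff_deriv.1 this).2.2
  have hc : Continuous w := hw.continuous
  have hd : Differentiable ℝ w := hw.differentiable (by norm_num)
  have hd' : Differentiable ℝ (deriv w) := hw'.differentiable (by norm_num)
  have hc'' : Continuous (deriv (deriv w)) := hw'.continuous_deriv (by norm_num)
  set M := ∫ y in (x - h/2)..(x + h/2), |deriv (deriv w) y| with hM
  have hM0 : 0 ≤ M := intervalIntegral.integral_nonneg (by linarith) (fun _ _ => abs_nonneg _)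
  have h1 : ∀ s ∈ Set.Icc (0:ℝ) (h/2), |deriv w (x + s) - deriv w (x - s)| ≤ M := by
    intro s hs
    have e : ∫ y in (x - s)..(x + s), deriv (deriv w) y = deriv w (x + s) - deriv w (x - s) :=
      intervalIntegral.integral_deriv_eq_sub (fun y _ => hd' y) (hc''.intervalIntegrable _ _)
    rw [← e]
    refine (intervalIntegral.abs_integral_le_integral_abs (by linarith [hs.1])).trans ?_
    refine intervalIntegral.integral_mono_interval (by linarith [hs.2]) (by linarith [hs.1])
      (by linarith [hs.2]) (Filter.Eventually.of_forall fun _ => abs_nonneg _)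
      (hc''.abs.intervalIntegrable _ _)
  have h2 : ∀ t ∈ Set.Icc (0:ℝ) (h/2), |(w (x + t) + w (x - t)) - (w (x + 0) + w (x - 0))| ≤ M * (t - 0) := by
    refine norm_image_sub_le_of_norm_deriv_le_segment' (f := fun t => w (x + t) + w (x - t))
      (f' := fun t => deriv w (x + t) - deriv w (x - t)) ?_ ?_
    · intro t _
      have a := (hd (x + t)).hasDerivAt.comp_const_add x t
      have b := (hd (x - t)).hasDerivAt.comp_const_sub x t
      have c := (a.add b).hasDerivWithinAt (s := Set.Icc (0:ℝ) (h/2))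
      rw [← sub_eq_add_neg] at c
      exact c
    · intro t ht
      exact h1 t ⟨ht.1, ht.2.le⟩
  have h3 : ∀ t ∈ Set.Icc (0:ℝ) (h/2), 2 * |w x| ≤ (|w (x + t)| + |w (x - t)|) + M * (h/2) := by
    intro t ht
    have a := h2 t ht
    simp only [add_zero, sub_zero] at a
    have b : M * t ≤ M * (h/2) := mul_le_mul_of_nonneg_left ht.2 hM0
    have c := abs_add_le (w (x + t)) (w (x - t))
    have d := abs_sub_abs_le_abs_sub (w x + w x) (w (x + t) + w (x - t))
    rw [abs_sub_comm] at d
    have e : |w x + w x| = 2 * |w x| := by rw [← two_mul, abs_mul]; norm_num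
    linarith
  have i1 : Continuous fun t => |w (x + t)| := by fun_prop
  have i2 : Continuous fun t => |w (x - t)| := by fun_prop
  have h4 := intervalIntegral.integral_mono_on (a := 0) (b := h/2) (μ := volume) (by linarith)
    (f := fun _ => 2 * |w x|) (g := fun t => (|w (x + t)| + |w (x - t)|) + M * (h/2))
    (continuous_const.intervalIntegrable _ _)
    (Continuous.intervalIntegrable (by fun_prop) _ _) h3
  rw [intervalIntegral.integral_add (Continuous.intervalIntegrable (by fun_prop) _ _)
    (continuous_const.intervalIntegrable _ _),
    intervalIntegral.integral_add (i1.intervalIntegrable _ _) (i2.intervalIntegrable _ _),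
    intervalIntegral.integral_comp_add_left (fun y => |w y|),
    intervalIntegral.integral_comp_sub_left (fun y => |w y|),
    intervalIntegral.integral_const, intervalIntegral.integral_const] at h4
  have h5 := intervalIntegral.integral_add_adjacent_intervals (μ := volume)
    (hc.abs.intervalIntegrable (x - h/2) x) (hc.abs.intervalIntegrable x (x + h/2))
  simp only [add_zero, sub_zero, smul_eq_mul] at h4
  nlinarith [mul_nonneg (sq_nonneg h) hM0]

lemma cell_hasSum (f : ℝ → ℝ) (h : ℝ) (hf : Integrable f) (hh : 0 < h) :
    HasSum (fun i : ℤ => ∫ y in ((i * h) - h/2)..((i * h) + h/2), f y) (∫ y, f y) := by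
  have H := hasSum_integral_iUnion (μ := volume) (f := f)
    (s := fun n : ℤ => Set.Ioc (-(h/2) + n • h) (-(h/2) + (n + 1) • h))
    (fun _ => measurableSet_Ioc) (Set.pairwise_disjoint_Ioc_add_zsmul _ _) hf.integrableOn
  rw [iUnion_Ioc_add_zsmul hh, setIntegral_univ] at H
  refine Eq.mp ?_ H
  congr 1
  funext i
  symm
  rw [intervalIntegral.integral_of_le (by linarith)]
  have e1 : (i:ℝ) * h - h/2 = -(h/2) + i • h := by simp; ring
  have e2 : (i:ℝ) * h + h/2 = -(h/2) + (i + 1) • h := by simp; ring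
  rw [e1, e2]

/-- **Grid restriction lies in `ℓ¹_h`** (second assertion of Lemma 2.2, regular case).
If `w` is twice continuously differentiable with `w`, `w'`, `w''` integrable on `ℝ`, and `h > 0`,
then `Σ_{i∈ℤ} h·|w(ih)|` converges and is bounded by `∫ |w| + h² ∫ |w''|`. -/
theorem grid_restriction_mem_l1h
    (w : ℝ → ℝ) (h : ℝ)
    (hw : ContDiff ℝ 2 w)
    (hw0 : Integrable w)
    (hw1 : Integrable (deriv w))
    (hw2 : Integrable (deriv (deriv w)))
    (hh : 0 < h) :
    Summable (fun i : ℤ => h * |w (i * h)|) ∧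
    (∑' i : ℤ, h * |w (i * h)|) ≤ (∫ x : ℝ, |w x|) + h ^ 2 * ∫ x : ℝ, |deriv (deriv w) x| := by
  have H := (cell_hasSum _ h hw0.abs hh).add ((cell_hasSum _ h hw2.abs hh).mul_left (h ^ 2))
  have hle := fun i : ℤ => cell_bound w h (i * h) hw hh
  have hs : Summable (fun i : ℤ => h * |w (i * h)|) :=
    Summable.of_nonneg_of_le (fun i => by positivity) hle H.summable
  exact ⟨hs, hasSum_le hle hs.hasSum H⟩
end

section
/- Let α : ℝ → ℝ be three times continuously differentiable with α′ and α‴ integrable on ℝ, and suppose additionally α and α″ are integrable. Then for every h > 0 the sequence D²_h α′_h, where α′_h = (α′(ih))_{i∈ℤ}, lies in ℓ¹_h and satisfies Σ_{i∈ℤ} h · |(α′((i+1)h) − 2α′(ih) + α′((i−1)h))/h²| ≤ 2 ∫_ℝ |α‴(x)| dx. -/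
open MeasureTheory

/-- **The difference sequence `D²_h α'_h` lies in `ℓ¹_h`** (Lemma 3.1, regular case).
If `α` is three times continuously differentiable with `α, α', α'', α'''` integrable and
`h > 0`, then `Σ_{i∈ℤ} h·|(α'((i+1)h) − 2α'(ih) + α'((i−1)h))/h²| ≤ 2 ∫ |α'''|`. -/
theorem D2h_alpha_prime_mem_l1h
    (α : ℝ → ℝ) (h : ℝ)
    (hα : ContDiff ℝ 3 α)
    (hα0 : Integrable α)
    (hα1 : Integrable (deriv α))
    (hα2 : Integrable (iteratedDeriv 2 α))
    (hα3 : Integrable (iteratedDeriv 3 α))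
    (hh : 0 < h) :
    Summable (fun i : ℤ =>
      h * |(deriv α ((i + 1) * h) - 2 * deriv α (i * h) + deriv α ((i - 1) * h)) / h ^ 2|) ∧
    (∑' i : ℤ,
      h * |(deriv α ((i + 1) * h) - 2 * deriv α (i * h) + deriv α ((i - 1) * h)) / h ^ 2|)
        ≤ 2 * ∫ x : ℝ, |iteratedDeriv 3 α x| := by
  set k := iteratedDeriv 3 α with hk
  have e2 : iteratedDeriv 2 α = deriv (deriv α) := by
    rw [iteratedDeriv_succ, iteratedDeriv_one]
  have e3 : k = deriv (deriv (deriv α)) := by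
    rw [hk, iteratedDeriv_succ, e2]
  have d1 : Differentiable ℝ (deriv α) := by
    have := hα.differentiable_iteratedDeriv 1 (by norm_num)
    rwa [iteratedDeriv_one] at this
  have d2 : Differentiable ℝ (deriv (deriv α)) := by
    have := hα.differentiable_iteratedDeriv 2 (by norm_num)
    rwa [e2] at this
  have kc : Continuous k := hα.continuous_iteratedDeriv 3 (by norm_num)
  have kabs : Integrable (fun x => |k x|) := hα3.abs
  have hS : HasSum (fun i : ℤ => ∫ x in Set.Ioc (i • h) ((i + 1) • h), |k x|) (∫ x, |k x|) := by
    have := hasSum_integral_iUnion (μ := volume) (f := fun x => |k x|)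
      (s := fun i : ℤ => Set.Ioc (i • h) ((i + 1) • h)) (fun _ => measurableSet_Ioc)
      (Set.pairwise_disjoint_Ioc_zsmul h) kabs.integrableOn
    rwa [iUnion_Ioc_zsmul hh, setIntegral_univ] at this
  set a : ℤ → ℝ := fun i : ℤ => ∫ x in Set.Ioc (i • h) ((i + 1) • h), |k x| with ha
  have hS' : HasSum (fun i : ℤ => a (i - 1)) (∫ x, |k x|) :=
    (Equiv.subRight (1 : ℤ)).hasSum_iff.mpr hS
  have hT : HasSum (fun i : ℤ => a (i - 1) + a i) (2 * ∫ x, |k x|) := by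
    rw [two_mul]; exact hS'.add hS
  have key : ∀ i : ℤ, h * |(deriv α ((i + 1) * h) - 2 * deriv α (i * h)
      + deriv α ((i - 1) * h)) / h ^ 2| ≤ a (i - 1) + a i := by
    intro i
    have ai : a i = ∫ x in (i * h)..((i + 1) * h), |k x| := by
      rw [intervalIntegral.integral_of_le (by nlinarith)]
      simp [ha]
    have ai' : a (i - 1) = ∫ x in ((i - 1) * h)..(i * h), |k x| := by
      rw [intervalIntegral.integral_of_le (by nlinarith)]
      simp [ha]
    have ii : ∀ u v : ℝ, IntervalIntegrable (fun x => |k x|) volume u v :=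
      fun u v => kc.abs.intervalIntegrable u v
    rw [ai, ai', intervalIntegral.integral_add_adjacent_intervals (ii _ _) (ii _ _)]
    obtain ⟨ξ, hξ, eξ⟩ := exists_deriv_eq_slope (deriv α)
      (show (i : ℝ) * h < (i + 1) * h by nlinarith) d1.continuous.continuousOn
      d1.differentiableOn
    obtain ⟨η, hη, eη⟩ := exists_deriv_eq_slope (deriv α)
      (show ((i : ℝ) - 1) * h < i * h by nlinarith) d1.continuous.continuousOn
      d1.differentiableOn
    have hle : η ≤ ξ := (hη.2.trans hξ.1).le
    have hI : ∫ x in η..ξ, k x = deriv (deriv α) ξ - deriv (deriv α) η := by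
      apply intervalIntegral.integral_eq_sub_of_hasDerivAt
      · intro x _
        rw [e3]
        exact (d2 x).hasDerivAt
      · exact kc.intervalIntegrable _ _
    have e : h * |(deriv α ((i + 1) * h) - 2 * deriv α (i * h)
      + deriv α ((i - 1) * h)) / h ^ 2| = |∫ x in η..ξ, k x| := by
      rw [hI, eξ, eη]
      nth_rewrite 1 [← abs_of_pos hh]
      rw [← abs_mul]
      congr 1
      have h1 : ((i : ℝ) + 1) * h - i * h = h := by ring
      have h2 : (i : ℝ) * h - (i - 1) * h = h := by ring
      rw [h1, h2]
      field_simp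
      ring
    rw [e]
    refine (intervalIntegral.abs_integral_le_integral_abs hle).trans ?_
    exact intervalIntegral.integral_mono_interval hη.1.le hle hξ.2.le
      (Filter.Eventually.of_forall fun x => abs_nonneg _) (ii _ _)
  have hs := Summable.of_nonneg_of_le (fun i => by positivity) key hT.summable
  exact ⟨hs, (hs.tsum_le_tsum key hT.summable).trans hT.tsum_eq.le⟩
end

section
/- Let α : ℝ → ℝ be three times continuously differentiable with α, α′, α″, α‴ integrable on ℝ, let κ > 0, T > 0, and let f : ℝ → ℝ be twice continuously differentiable with f(0) = 0. Let u : [0, T] × ℝ → ℝ be such that: for each t, x ↦ u(t, x) is four times differentiable with u and its first four spatial derivatives bounded uniformly on [0,T] × ℝ by a constant M̃; u(t, ·) and its first two spatial derivatives are integrable uniformly in t; and u satisfies ∂_t u(t, x) = −(α′ ∗ f(u(t, ·)))(x) − κ·(α‴ ∗ u(t, ·))(x) for all (t, x). Set M = sup_{t,x} |u(t, x)|. Then there is a constant C > 0, independent of h, such that for every h ∈ (0, 1] and every v : [0, T] → ℓ^∞(ℤ) satisfying v_i(0) = u(0, ih), sup_{t,i} |v_i(t)| ≤ 2M, and dv_i/dt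 = −Σ_j h·α′((i−j)h) f(v_j(t)) − κ·Σ_j h·[(α′((i−j+1)h) − 2α′((i−j)h) + α′((i−j−1)h))/h²]·v_j(t) for all i ∈ ℤ and t ∈ [0, T], one has sup_{t ∈ [0,T]} sup_{i ∈ ℤ} |u(t, ih) − v_i(t)| ≤ C·h². -/
open MeasureTheory

lemma sq_cells {g : ℝ → ℝ} (hg : Integrable g) {h : ℝ} (hh : 0 < h) (c : ℝ) :
    HasSum (fun n : ℤ => ∫ y in (c + n * h)..(c + (n + 1) * h), g y) (∫ y, g y) := by
  have h1 := (hg.comp_mul_left' hh.ne').hasSum_intervalIntegral (c / h)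
  have h2 := h1.mul_left h
  rw [Measure.integral_comp_mul_left, abs_of_pos (inv_pos.mpr hh), smul_eq_mul,
    mul_inv_cancel_left₀ hh.ne'] at h2
  have e : (fun n : ℤ => ∫ y in (c + n * h)..(c + (n + 1) * h), g y) =
      fun i : ℤ => h * ∫ x in (c / h + i)..(c / h + i + 1), g (h * x) := by
    funext n
    rw [intervalIntegral.mul_integral_comp_mul_left]
    congr 1 <;> field_simp
    ring
  rw [e]
  exact h2

lemma sq_first {g g' : ℝ → ℝ} (hd : ∀ x, HasDerivAt g (g' x) x) (hg' : Integrable g')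
    {p q a y : ℝ} (ha : a ∈ Set.Icc p q) (hy : y ∈ Set.Icc p q) :
    |g y - g a| ≤ ∫ z in p..q, |g' z| := by
  wlog hay : a ≤ y generalizing a y
  · rw [abs_sub_comm]
    exact this hy ha (le_of_not_ge hay)
  rw [← intervalIntegral.integral_eq_sub_of_hasDerivAt (fun x _ => hd x) hg'.intervalIntegrable]
  refine (intervalIntegral.abs_integral_le_integral_abs hay).trans ?_
  exact intervalIntegral.integral_mono_interval ha.1 hay hy.2
    (Filter.Eventually.of_forall fun x => abs_nonneg _) hg'.abs.intervalIntegrable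

lemma sq_taylor {g g' g'' : ℝ → ℝ} (hd : ∀ x, HasDerivAt g (g' x) x)
    (hd' : ∀ x, HasDerivAt g' (g'' x) x) (hg'' : Integrable g'')
    {p q a y : ℝ} (ha : a ∈ Set.Icc p q) (hy : y ∈ Set.Icc p q) :
    |g y - g a - g' a * (y - a)| ≤ (∫ z in p..q, |g'' z|) * |y - a| := by
  have := Convex.norm_image_sub_le_of_norm_hasDerivWithin_le (𝕜 := ℝ)
    (f := fun z => g z - g' a * z) (f' := fun z => g' z - g' a) (s := Set.Icc p q) (x := a) (y := y)
    (C := ∫ z in p..q, |g'' z|)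
    (fun x _ => by
      have := (hd x).sub ((hasDerivAt_id x).const_mul (g' a))
      exact (this.congr_deriv (by simp)).hasDerivWithinAt)
    (fun x hx => sq_first hd' hg'' ha hx) (convex_Icc p q) ha hy
  simp only [Real.norm_eq_abs] at this
  convert this using 2
  ring

/-- grid sum bound -/
lemma sq_gridsum {g g' : ℝ → ℝ} (hd : ∀ x, HasDerivAt g (g' x) x) (hg : Integrable g)
    (hg' : Integrable g') {h : ℝ} (hh : 0 < h) :
    Summable (fun n : ℤ => |h * g (n * h)|) ∧
    ∑' n : ℤ, |h * g (n * h)| ≤ (∫ y, |g y|) + h * ∫ y, |g' y| := by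
  have hs := (sq_cells hg.abs hh 0).add ((sq_cells hg'.abs hh 0).mul_left h)
  have hb : ∀ n : ℤ, |h * g (n * h)| ≤ (∫ y in (0 + n * h)..(0 + (n + 1) * h), |g y|) +
      h * ∫ y in (0 + n * h)..(0 + (n + 1) * h), |g' y| := by
    intro n
    set p : ℝ := 0 + n * h with hp
    set q : ℝ := 0 + (n + 1) * h with hq
    have hpq : q - p = h := by rw [hp, hq]; ring
    have hle : p ≤ q := by linarith
    have hpn : (n : ℝ) * h = p := by rw [hp]; ring
    rw [hpn, abs_mul, abs_of_pos hh]
    have h1 : ∫ y in p..q, (|g p| - ∫ z in p..q, |g' z|) ≤ ∫ y in p..q, |g y| := by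
      refine intervalIntegral.integral_mono_on hle (by simp) hg.abs.intervalIntegrable ?_
      intro y hy
      have := sq_first hd hg' (Set.left_mem_Icc.2 hle) hy
      have h2 := abs_sub_abs_le_abs_sub (g p) (g y)
      rw [abs_sub_comm] at h2
      linarith
    rw [intervalIntegral.integral_const, hpq, smul_eq_mul] at h1
    linarith
  have hsum := Summable.of_nonneg_of_le (fun n => abs_nonneg _) hb hs.summable
  exact ⟨hsum, hasSum_le hb hsum.hasSum hs⟩

/-- second difference sum bound -/
lemma sq_seconddiff {g g' g'' : ℝ → ℝ} (hd : ∀ x, HasDerivAt g (g' x) x)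
    (hd' : ∀ x, HasDerivAt g' (g'' x) x) (hg'' : Integrable g'') {h : ℝ} (hh : 0 < h) :
    Summable (fun n : ℤ => |h * ((g ((n + 1) * h) - 2 * g (n * h) + g ((n - 1) * h)) / h ^ 2)|) ∧
    ∑' n : ℤ, |h * ((g ((n + 1) * h) - 2 * g (n * h) + g ((n - 1) * h)) / h ^ 2)|
      ≤ 2 * (2 * ∫ y, |g'' y|) := by
  have hs := ((sq_cells hg''.abs hh 0).add (sq_cells hg''.abs hh (-h))).mul_left 2
  rw [← two_mul] at hs
  have hb : ∀ n : ℤ, |h * ((g ((n + 1) * h) - 2 * g (n * h) + g ((n - 1) * h)) / h ^ 2)| ≤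
      2 * ((∫ y in (0 + n * h)..(0 + (n + 1) * h), |g'' y|) +
      ∫ y in (-h + n * h)..(-h + (n + 1) * h), |g'' y|) := by
    intro n
    have e1 : (0 + n * h : ℝ) = n * h := by ring
    have e2 : (-h + (n + 1) * h : ℝ) = n * h := by ring
    have e3 : (0 + (n + 1) * h : ℝ) = (n + 1) * h := by ring
    have e4 : (-h + n * h : ℝ) = (n - 1) * h := by ring
    rw [e1, e2, e3, e4, add_comm (∫ y in _.._, _) (∫ y in _.._, _),
      intervalIntegral.integral_add_adjacent_intervals hg''.abs.intervalIntegrable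
        hg''.abs.intervalIntegrable]
    set a : ℝ := n * h
    have ep : ((n : ℝ) + 1) * h = a + h := by simp only [a]; ring
    have em : ((n : ℝ) - 1) * h = a - h := by simp only [a]; ring
    rw [ep, em]
    set I := ∫ z in (a - h)..(a + h), |g'' z|
    have t1 := sq_taylor hd hd' hg'' (p := a - h) (q := a + h) (a := a) (y := a + h)
      ⟨by linarith, by linarith⟩ ⟨by linarith, by linarith⟩
    have t2 := sq_taylor hd hd' hg'' (p := a - h) (q := a + h) (a := a) (y := a - h)
      ⟨by linarith, by linarith⟩ ⟨by linarith, by linarith⟩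
    rw [show a + h - a = h by ring, abs_of_pos hh] at t1
    rw [show a - h - a = -h by ring, abs_neg, abs_of_pos hh] at t2
    have t3 : |g (a + h) - 2 * g a + g (a - h)| ≤ 2 * (I * h) := by
      have : g (a + h) - 2 * g a + g (a - h) =
        (g (a + h) - g a - g' a * h) + (g (a - h) - g a - g' a * -h) := by ring
      rw [this]
      exact (abs_add_le _ _).trans (by linarith)
    rw [abs_mul, abs_div, abs_of_pos hh, abs_of_pos (pow_pos hh 2)]
    calc h * (|g (a + h) - 2 * g a + g (a - h)| / h ^ 2) ≤ h * (2 * (I * h) / h ^ 2) := by gcongr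
      _ = 2 * I := by field_simp
  have hsum := Summable.of_nonneg_of_le (fun n => abs_nonneg _) hb hs.summable
  exact ⟨hsum, hasSum_le hb hsum.hasSum hs⟩

/-- midpoint quadrature -/
lemma sq_quad {g g' g'' : ℝ → ℝ} (hd : ∀ x, HasDerivAt g (g' x) x)
    (hd' : ∀ x, HasDerivAt g' (g'' x) x) (hg : Integrable g) (hg' : Integrable g')
    (hg'' : Integrable g'') {h : ℝ} (hh : 0 < h) :
    |(∫ y, g y) - ∑' n : ℤ, h * g (n * h)| ≤ h ^ 2 * ∫ y, |g'' y| := by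
  have hs := (sq_gridsum hd hg hg' hh).1.of_abs
  have hc := sq_cells hg hh (-(h / 2))
  have hc2 := (sq_cells hg''.abs hh (-(h / 2))).mul_left (h ^ 2)
  have hsub := hc.sub hs.hasSum
  rw [← hsub.tsum_eq, ← Real.norm_eq_abs]
  refine tsum_of_norm_bounded hc2 ?_
  intro n
  set a : ℝ := n * h with ha
  have e1 : -(h / 2) + a = a - h / 2 := by ring
  have e2 : -(h / 2) + ((n : ℝ) + 1) * h = a + h / 2 := by rw [ha]; ring
  rw [e1, e2]
  set I := ∫ z in (a - h / 2)..(a + h / 2), |g'' z|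
  have hI : 0 ≤ I := intervalIntegral.integral_nonneg (by linarith) fun _ _ => abs_nonneg _
  have key : (∫ y in (a - h / 2)..(a + h / 2), g y) - h * g a =
      ∫ y in (a - h / 2)..(a + h / 2), (g y - g a - g' a * (y - a)) := by
    rw [intervalIntegral.integral_sub, intervalIntegral.integral_sub hg.intervalIntegrable (by simp),
      intervalIntegral.integral_const_mul, intervalIntegral.integral_sub]
    · simp only [intervalIntegral.integral_const, integral_id, smul_eq_mul]
      ring
    · exact continuous_id.intervalIntegrable _ _
    · simp
    · exact hg.intervalIntegrable.sub (by simp)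
    · exact Continuous.intervalIntegrable (by fun_prop) _ _
  rw [key]
  have := intervalIntegral.norm_integral_le_of_norm_le_const (a := a - h / 2) (b := a + h / 2)
    (f := fun y => g y - g a - g' a * (y - a)) (C := I * h) (by
      intro y hy
      rw [Set.uIoc_of_le (by linarith)] at hy
      refine (sq_taylor hd hd' hg'' (p := a - h / 2) (q := a + h / 2)
        ⟨by linarith, by linarith⟩ ⟨hy.1.le, hy.2⟩).trans ?_
      refine mul_le_mul_of_nonneg_left ?_ hI
      rw [abs_le]; constructor <;> linarith [hy.1, hy.2])
  refine this.trans (le_of_eq ?_)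
  rw [show a + h / 2 - (a - h / 2) = h by ring, abs_of_pos hh]; ring

lemma sq_zero_bound {F F' : ℝ → ℝ} {h B : ℝ} (h0 : F 0 = 0)
    (hd : ∀ s, HasDerivAt F (F' s) s) (hB : ∀ s ∈ Set.Icc 0 h, |F' s| ≤ B) :
    ∀ s ∈ Set.Icc 0 h, |F s| ≤ B * h := by
  intro s hs
  have hh : 0 ≤ h := hs.1.trans hs.2
  have hB0 : 0 ≤ B := (abs_nonneg _).trans (hB s hs)
  have := Convex.norm_image_sub_le_of_norm_hasDerivWithin_le (𝕜 := ℝ)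
    (fun x _ => (hd x).hasDerivWithinAt) hB (convex_Icc 0 h) (Set.left_mem_Icc.2 hh) hs
  rw [h0, sub_zero, sub_zero, Real.norm_eq_abs, Real.norm_eq_abs, abs_of_nonneg hs.1] at this
  exact this.trans (mul_le_mul_of_nonneg_left hs.2 hB0)

lemma sq_fourth {u0 u1 u2 u3 u4 : ℝ → ℝ} (h0 : ∀ x, HasDerivAt u0 (u1 x) x)
    (h1 : ∀ x, HasDerivAt u1 (u2 x) x) (h2 : ∀ x, HasDerivAt u2 (u3 x) x)
    (h3 : ∀ x, HasDerivAt u3 (u4 x) x) {B : ℝ} (hB : ∀ x, |u4 x| ≤ B) {h : ℝ} (hh : 0 < h) (x : ℝ) :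
    |(u0 (x + h) - 2 * u0 x + u0 (x - h)) / h ^ 2 - u2 x| ≤ 2 * B * h ^ 2 := by
  have P : ∀ {a b : ℝ → ℝ}, (∀ x, HasDerivAt a (b x) x) → ∀ s, HasDerivAt (fun s => a (x + s))
      (b (x + s)) s := fun hab s => by
    simpa using (hab (x + s)).comp_const_add x s
  have N : ∀ {a b : ℝ → ℝ}, (∀ x, HasDerivAt a (b x) x) → ∀ s, HasDerivAt (fun s => a (x - s))
      (-b (x - s)) s := fun hab s => by
    simpa using (hab (x - s)).comp_const_sub x s
  have b3 := sq_zero_bound (F := fun s => u3 (x + s) - u3 (x - s))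
    (F' := fun s => u4 (x + s) + u4 (x - s)) (h := h) (B := 2 * B) (by simp)
    (fun s => ((P h3 s).sub (N h3 s)).congr_deriv (by ring))
    (fun s _ => (abs_add_le _ _).trans (by linarith [hB (x + s), hB (x - s)]))
  have b2 := sq_zero_bound (F := fun s => u2 (x + s) + u2 (x - s) - 2 * u2 x)
    (F' := fun s => u3 (x + s) - u3 (x - s)) (h := h) (by simp; ring)
    (fun s => by simpa [sub_eq_add_neg] using ((P h2 s).add (N h2 s)).sub_const (2 * u2 x)) b3
  have b1 := sq_zero_bound (F := fun s => u1 (x + s) - u1 (x - s) - (2 * u2 x) * s)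
    (F' := fun s => u2 (x + s) + u2 (x - s) - 2 * u2 x) (h := h) (by simp)
    (fun s => (((P h1 s).sub (N h1 s)).sub ((hasDerivAt_id s).const_mul (2 * u2 x))).congr_deriv (by ring)) b2
  have b0 := sq_zero_bound (F := fun s => u0 (x + s) + u0 (x - s) - 2 * u0 x - u2 x * s ^ 2)
    (F' := fun s => u1 (x + s) - u1 (x - s) - (2 * u2 x) * s) (h := h) (by simp; ring)
    (fun s => by
      have := (((P h0 s).add (N h0 s)).sub_const (2 * u0 x)).sub
        (((hasDerivAt_id s).pow 2).const_mul (u2 x))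
      exact this.congr_deriv (by simp; ring)) b1 h (Set.right_mem_Icc.2 hh.le)
  have e : (u0 (x + h) - 2 * u0 x + u0 (x - h)) / h ^ 2 - u2 x =
    (u0 (x + h) + u0 (x - h) - 2 * u0 x - u2 x * h ^ 2) / h ^ 2 := by field_simp; ring
  rw [e, abs_div, abs_of_pos (pow_pos hh 2), div_le_iff₀ (pow_pos hh 2)]
  refine b0.trans (le_of_eq ?_)
  ring

/-- discrete Young -/
lemma sq_conv {b w : ℤ → ℝ} {S W : ℝ} (hb : Summable fun n => |b n|) (hS : ∑' n, |b n| ≤ S)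
    (hw : ∀ j, |w j| ≤ W) (i : ℤ) :
    Summable (fun j => b (i - j) * w j) ∧ |∑' j, b (i - j) * w j| ≤ S * W := by
  have hW : 0 ≤ W := (abs_nonneg _).trans (hw 0)
  have hs : Summable (fun j => |b (i - j)|) := (Equiv.subLeft i).summable_iff.2 hb
  have ht : ∑' j, |b (i - j)| = ∑' n, |b n| := (Equiv.subLeft i).tsum_eq (fun n => |b n|)
  have hs2 := hs.mul_right W
  have hle : ∀ j, ‖b (i - j) * w j‖ ≤ |b (i - j)| * W := fun j => by
    rw [Real.norm_eq_abs, abs_mul]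
    exact mul_le_mul_of_nonneg_left (hw j) (abs_nonneg _)
  refine ⟨hs2.of_norm_bounded hle, ?_⟩
  have := tsum_of_norm_bounded hs2.hasSum hle
  rw [tsum_mul_right, ht] at this
  exact this.trans (mul_le_mul_of_nonneg_right hS hW)

lemma sq_int_mul {a F : ℝ → ℝ} (ha : Integrable a) (hF : AEStronglyMeasurable F volume) {B : ℝ}
    (hB : ∀ y, |F y| ≤ B) (x : ℝ) : Integrable (fun y => a (x - y) * F y) :=
  (ha.comp_sub_left x).mul_bdd hF (Filter.Eventually.of_forall hB)

lemma sq_int_mul_le {a F : ℝ → ℝ} (ha : Integrable a) (hF : AEStronglyMeasurable F volume) {B : ℝ}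
    (hB : ∀ y, |F y| ≤ B) (x : ℝ) : ∫ y, |a (x - y) * F y| ≤ (∫ y, |a y|) * B := by
  rw [← integral_sub_left_eq_self (fun y => |a y|) volume x, ← integral_mul_const]
  refine integral_mono (sq_int_mul ha hF hB x).abs ((ha.comp_sub_left x).abs.mul_const B) ?_
  intro y
  simp only [abs_mul]
  exact mul_le_mul_of_nonneg_left (hB y) (abs_nonneg _)

lemma sq_meas {F F' : ℝ → ℝ} (hd : ∀ x, HasDerivAt F (F' x) x) :
    AEStronglyMeasurable F' (volume : Measure ℝ) := by
  have : F' = deriv F := by funext x; exact (hd x).deriv.symm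
  rw [this]
  exact (measurable_deriv F).aestronglyMeasurable

lemma sq_cont {F F' : ℝ → ℝ} (hd : ∀ x, HasDerivAt F (F' x) x) : Continuous F :=
  continuous_iff_continuousAt.2 fun x => (hd x).continuousAt

lemma sq_refl {a b : ℝ → ℝ} (hab : ∀ x, HasDerivAt a (b x) x) (x s : ℝ) :
    HasDerivAt (fun s => a (x - s)) (-b (x - s)) s := by
  simpa using (hab (x - s)).comp_const_sub x s

lemma sq_prod {a1 a2 a3 F F1 F2 : ℝ → ℝ} (h1 : ∀ x, HasDerivAt a1 (a2 x) x)
    (h2 : ∀ x, HasDerivAt a2 (a3 x) x) (i1 : Integrable a1) (i2 : Integrable a2)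
    (i3 : Integrable a3) (hF : ∀ x, HasDerivAt F (F1 x) x) (hF1 : ∀ x, HasDerivAt F1 (F2 x) x)
    {B : ℝ} (b0 : ∀ x, |F x| ≤ B) (b1 : ∀ x, |F1 x| ≤ B) (b2 : ∀ x, |F2 x| ≤ B)
    {h : ℝ} (hh : 0 < h) (x : ℝ) :
    |(∫ y, a1 (x - y) * F y) - ∑' n : ℤ, h * (a1 (x - n * h) * F (n * h))| ≤
      h ^ 2 * (B * ((∫ y, |a3 y|) + 2 * (∫ y, |a2 y|) + ∫ y, |a1 y|)) := by
  have m0 := (sq_cont hF).aestronglyMeasurable (μ := (volume : Measure ℝ))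
  have m1 := sq_meas hF
  have m2 := sq_meas hF1
  have j30 := sq_int_mul i3 m0 b0 x
  have j21 := sq_int_mul i2 m1 b1 x
  have j12 := sq_int_mul i1 m2 b2 x
  have j20 := sq_int_mul i2 m0 b0 x
  have j11 := sq_int_mul i1 m1 b1 x
  have j10 := sq_int_mul i1 m0 b0 x
  have ig2 : Integrable (fun y => a3 (x - y) * F y - 2 * (a2 (x - y) * F1 y) + a1 (x - y) * F2 y) :=
    (j30.sub (j21.const_mul 2)).add j12
  have q := sq_quad (g := fun y => a1 (x - y) * F y)
    (g' := fun y => a1 (x - y) * F1 y - a2 (x - y) * F y)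
    (g'' := fun y => a3 (x - y) * F y - 2 * (a2 (x - y) * F1 y) + a1 (x - y) * F2 y)
    (fun y => ((sq_refl h1 x y).mul (hF y)).congr_deriv (by ring))
    (fun y => (((sq_refl h1 x y).mul (hF1 y)).sub ((sq_refl h2 x y).mul (hF y))).congr_deriv
      (by ring)) j10 (j11.sub j20) ig2 hh
  refine q.trans (mul_le_mul_of_nonneg_left ?_ (by positivity))
  have e30 := sq_int_mul_le i3 m0 b0 x
  have e21 := sq_int_mul_le i2 m1 b1 x
  have e12 := sq_int_mul_le i1 m2 b2 x
  have : ∫ y, |a3 (x - y) * F y - 2 * (a2 (x - y) * F1 y) + a1 (x - y) * F2 y| ≤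
      ∫ y, (|a3 (x - y) * F y| + 2 * |a2 (x - y) * F1 y| + |a1 (x - y) * F2 y|) := by
    refine integral_mono ig2.abs ((j30.abs.add (j21.abs.const_mul 2)).add j12.abs) ?_
    intro y
    refine (abs_add_le _ _).trans (add_le_add_left ((abs_sub _ _).trans ?_) _)
    rw [abs_mul 2, abs_two]
  have j3 : Integrable (fun y => |a3 (x - y) * F y| + 2 * |a2 (x - y) * F1 y|) :=
    j30.abs.add (j21.abs.const_mul 2)
  rw [integral_add j3 j12.abs,
    integral_add j30.abs (j21.abs.const_mul 2), integral_const_mul] at this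
  linarith

lemma sq_ibp {a a' w w' : ℝ → ℝ} (ha : ∀ x, HasDerivAt a (a' x) x)
    (hw : ∀ x, HasDerivAt w (w' x) x) (i : Integrable a) (i' : Integrable a') {B : ℝ}
    (b : ∀ x, |w x| ≤ B) (b' : ∀ x, |w' x| ≤ B) (x : ℝ) :
    ∫ y, a' (x - y) * w y = ∫ y, a (x - y) * w' y := by
  have m0 := (sq_cont hw).aestronglyMeasurable (μ := (volume : Measure ℝ))
  have m1 := sq_meas hw
  have := integral_mul_deriv_eq_deriv_mul_of_integrable (u := fun y => a (x - y))
    (u' := fun y => -a' (x - y)) (v := w) (v' := w') (fun y _ => sq_refl ha x y) (fun y _ => hw y)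
    (sq_int_mul i m1 b' x) (by
      have := (sq_int_mul i' m0 b x).neg
      refine this.congr (Filter.Eventually.of_forall fun y => ?_)
      simp) (sq_int_mul i m0 b x)
  rw [this, ← integral_neg]
  simp

lemma sq_sbp {b w : ℤ → ℝ} {W : ℝ} (hb : Summable fun n => |b n|)
    (hw : ∀ j, |w j| ≤ W) (i : ℤ) :
    ∑' j, (b (i - j + 1) - 2 * b (i - j) + b (i - j - 1)) * w j =
      ∑' j, b (i - j) * (w (j + 1) - 2 * w j + w (j - 1)) := by
  have s0 := (sq_conv hb le_rfl hw i).1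
  have sp := (sq_conv hb le_rfl hw (i + 1)).1
  have sm := (sq_conv hb le_rfl hw (i - 1)).1
  have tp := (sq_conv hb le_rfl (fun j => hw (j + 1)) i).1
  have tm := (sq_conv hb le_rfl (fun j => hw (j - 1)) i).1
  have ep : ∑' j, b (i + 1 - j) * w j = ∑' j, b (i - j) * w (j + 1) := by
    rw [← (Equiv.addRight (1 : ℤ)).tsum_eq]
    refine tsum_congr fun j => ?_
    simp only [Equiv.coe_addRight]
    congr 2; ring
  have em : ∑' j, b (i - 1 - j) * w j = ∑' j, b (i - j) * w (j - 1) := by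
    rw [← (Equiv.subRight (1 : ℤ)).tsum_eq]
    refine tsum_congr fun j => ?_
    simp only [Equiv.subRight_apply]
    congr 2; ring
  have L : ∑' j, (b (i - j + 1) - 2 * b (i - j) + b (i - j - 1)) * w j =
      ∑' j, b (i + 1 - j) * w j - 2 * ∑' j, b (i - j) * w j + ∑' j, b (i - 1 - j) * w j := by
    rw [← tsum_mul_left, ← sp.tsum_sub (s0.mul_left 2), ← (sp.sub (s0.mul_left 2)).tsum_add sm]
    refine tsum_congr fun j => ?_
    rw [show i + 1 - j = i - j + 1 by ring, show i - 1 - j = i - j - 1 by ring]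
    ring
  have R : ∑' j, b (i - j) * (w (j + 1) - 2 * w j + w (j - 1)) =
      ∑' j, b (i - j) * w (j + 1) - 2 * ∑' j, b (i - j) * w j + ∑' j, b (i - j) * w (j - 1) := by
    rw [← tsum_mul_left, ← tp.tsum_sub (s0.mul_left 2), ← (tp.sub (s0.mul_left 2)).tsum_add tm]
    refine tsum_congr fun j => ?_
    ring
  rw [L, R, ep, em]

lemma sq_gronwall {e e' : ℝ → ℤ → ℝ} {B D T W : ℝ} (hB : 0 < B) (hD : 0 ≤ D)
    (hd : ∀ i, ∀ t ∈ Set.Icc (0 : ℝ) T, HasDerivAt (fun s => e s i) (e' t i) t)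
    (h0 : ∀ i, e 0 i = 0) (hW : ∀ t ∈ Set.Icc (0 : ℝ) T, ∀ i, |e t i| ≤ W)
    (hr : ∀ t ∈ Set.Icc (0 : ℝ) T, ∀ E, (∀ j, |e t j| ≤ E) → ∀ i, |e' t i| ≤ B * E + D) :
    ∀ t ∈ Set.Icc (0 : ℝ) T, ∀ i, |e t i| ≤ 2 * D * T * Real.exp (2 * B * T) := by
  intro t0 ht0
  have hT : 0 ≤ T := ht0.1.trans ht0.2
  have hW0 : 0 ≤ W := (abs_nonneg _).trans (hW t0 ht0 0)
  have step : ∀ n : ℕ, ∀ t ∈ Set.Icc (0 : ℝ) T, ∀ i,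
      |e t i| ≤ (2 * D * T + W * (1 / 2) ^ n) * Real.exp (2 * B * t) := by
    intro n
    induction n with
    | zero =>
      intro t ht i
      have h1 : 1 ≤ Real.exp (2 * B * t) := Real.one_le_exp (by have := ht.1; positivity)
      have h2 : 0 ≤ 2 * D * T + W * (1 / 2) ^ 0 := by positivity
      have h3 : 0 ≤ D * T := by positivity
      refine (hW t ht i).trans ?_
      have := le_mul_of_one_le_right h2 h1
      simp only [pow_zero, mul_one] at this ⊢
      linarith
    | succ n ih =>
      intro t ht i
      set S := 2 * D * T + W * (1 / 2) ^ n with hS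
      have hexp : ∀ x, HasDerivAt (fun x => S / 2 * Real.exp (2 * B * x) - S / 2 + D * x)
          (B * (S * Real.exp (2 * B * x)) + D) x := by
        intro x
        have := (((((hasDerivAt_id x).const_mul (2 * B)).exp).const_mul (S / 2)).sub_const
          (S / 2)).add ((hasDerivAt_id x).const_mul D)
        exact this.congr_deriv (by simp; ring)
      have := image_norm_le_of_norm_deriv_right_le_deriv_boundary (f := fun s => e s i)
        (f' := fun s => e' s i) (a := 0) (b := T)
        (fun s hs => (hd i s hs).continuousAt.continuousWithinAt)
        (fun s hs => (hd i s ⟨hs.1, hs.2.le⟩).hasDerivWithinAt)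
        (B := fun x => S / 2 * Real.exp (2 * B * x) - S / 2 + D * x)
        (by simp [h0]) hexp
        (fun s hs => hr s ⟨hs.1, hs.2.le⟩ _ (ih s ⟨hs.1, hs.2.le⟩) i) ht
      refine this.trans ?_
      have h1 : 1 ≤ Real.exp (2 * B * t) := Real.one_le_exp (by have := ht.1; positivity)
      have hS0 : 0 ≤ S := by positivity
      have h3 : D * t ≤ D * T := mul_le_mul_of_nonneg_left ht.2 hD
      have h4 : D * T ≤ D * T * Real.exp (2 * B * t) := le_mul_of_one_le_right (by positivity) h1
      have h5 : 2 * D * T + W * (1 / 2) ^ (n + 1) = S / 2 + D * T := by rw [hS]; ring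
      rw [h5, add_mul]
      linarith
  intro i
  have lim : Filter.Tendsto (fun n : ℕ => (2 * D * T + W * (1 / 2) ^ n) * Real.exp (2 * B * t0))
      Filter.atTop (nhds ((2 * D * T + W * 0) * Real.exp (2 * B * t0))) :=
    ((tendsto_const_nhds.add ((tendsto_pow_atTop_nhds_zero_of_lt_one (by norm_num)
      (by norm_num)).const_mul W)).mul_const _)
  have := ge_of_tendsto' lim (fun n => step n t0 ht0 i)
  refine this.trans ?_
  rw [mul_zero, add_zero]
  refine mul_le_mul_of_nonneg_left (Real.exp_le_exp.2 ?_) (by positivity)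
  exact mul_le_mul_of_nonneg_left ht0.2 (by positivity)

lemma sq_rate {a1 a2 a3 F F1 F2 U0 U1 U2 U3 U4 : ℝ → ℝ} (h1 : ∀ x, HasDerivAt a1 (a2 x) x)
    (h2 : ∀ x, HasDerivAt a2 (a3 x) x) (i1 : Integrable a1) (i2 : Integrable a2)
    (i3 : Integrable a3) (hF : ∀ x, HasDerivAt F (F1 x) x) (hF1 : ∀ x, HasDerivAt F1 (F2 x) x)
    {B : ℝ} (b0 : ∀ x, |F x| ≤ B) (b1 : ∀ x, |F1 x| ≤ B) (b2 : ∀ x, |F2 x| ≤ B)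
    (hU0 : ∀ x, HasDerivAt U0 (U1 x) x) (hU1 : ∀ x, HasDerivAt U1 (U2 x) x)
    (hU2 : ∀ x, HasDerivAt U2 (U3 x) x) (hU3 : ∀ x, HasDerivAt U3 (U4 x) x) {Mt : ℝ}
    (c0 : ∀ x, |U0 x| ≤ Mt) (c1 : ∀ x, |U1 x| ≤ Mt) (c2 : ∀ x, |U2 x| ≤ Mt)
    (c3 : ∀ x, |U3 x| ≤ Mt) (c4 : ∀ x, |U4 x| ≤ Mt)
    {κ L : ℝ} (hκ : 0 < κ) {h : ℝ} (hh : 0 < h) (hh1 : h ≤ 1) (i : ℤ) (v fv : ℤ → ℝ) {E : ℝ}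
    (hv : ∀ j : ℤ, |U0 (j * h) - v j| ≤ E) (hfv : ∀ j : ℤ, |F (j * h) - fv j| ≤ L * E) :
    |(-(∫ y, a1 (i * h - y) * F y) - κ * ∫ y, a3 (i * h - y) * U0 y) -
      (-(∑' j : ℤ, h * a1 (((i - j : ℤ) : ℝ) * h) * fv j) -
            κ * ∑' j : ℤ, h * ((a1 (((i - j + 1 : ℤ) : ℝ) * h) -
              2 * a1 (((i - j : ℤ) : ℝ) * h) +
              a1 (((i - j - 1 : ℤ) : ℝ) * h)) / h ^ 2) * v j)| ≤
    (((∫ y, |a1 y|) + ∫ y, |a2 y|) * L + κ * (4 * ∫ y, |a3 y|)) * E +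
    (B * ((∫ y, |a3 y|) + 2 * (∫ y, |a2 y|) + ∫ y, |a1 y|) +
      κ * (Mt * ((∫ y, |a3 y|) + 2 * (∫ y, |a2 y|) + ∫ y, |a1 y|) +
        ((∫ y, |a1 y|) + ∫ y, |a2 y|) * (2 * Mt))) * h ^ 2 := by
  set N1 := ∫ y, |a1 y|
  set N2 := ∫ y, |a2 y| with hN2
  set N3 := ∫ y, |a3 y|
  have hN2' : 0 ≤ N2 := integral_nonneg fun _ => abs_nonneg _
  obtain ⟨sb, tb⟩ := sq_gridsum h1 i1 i2 hh
  obtain ⟨sd, td⟩ := sq_seconddiff h1 h2 i3 hh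
  have q1 := sq_prod h1 h2 i1 i2 i3 hF hF1 b0 b1 b2 hh (i * h)
  have q2 := sq_prod h1 h2 i1 i2 i3 hU2 hU3 c2 c3 c4 hh (i * h)
  have hib : ∫ y, a3 (i * h - y) * U0 y = ∫ y, a1 (i * h - y) * U2 y :=
    (sq_ibp h2 hU0 i2 i3 c0 c1 _).trans (sq_ibp h1 hU1 i1 i2 c1 c2 _)
  set b : ℤ → ℝ := fun n => h * a1 (n * h) with hbdef
  set d : ℤ → ℝ := fun n => h * ((a1 ((n + 1) * h) - 2 * a1 (n * h) + a1 ((n - 1) * h)) / h ^ 2)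
    with hddef
  have tb' : ∑' n, |b n| ≤ N1 + N2 := tb.trans (by
    have := mul_le_of_le_one_left hN2' hh1
    linarith)
  have ev : ∑' j : ℤ, h * ((a1 (((i - j + 1 : ℤ) : ℝ) * h) - 2 * a1 (((i - j : ℤ) : ℝ) * h) +
              a1 (((i - j - 1 : ℤ) : ℝ) * h)) / h ^ 2) * v j = ∑' j, d (i - j) * v j := by
    refine tsum_congr fun j => ?_
    simp only [hddef]; push_cast; rfl
  have ef : ∑' j : ℤ, h * a1 (((i - j : ℤ) : ℝ) * h) * fv j = ∑' j, b (i - j) * fv j := rfl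
  have eq1 : ∀ G : ℝ → ℝ, ∑' n : ℤ, h * (a1 (i * h - n * h) * G (n * h)) =
      ∑' j : ℤ, b (i - j) * G (j * h) := by
    intro G
    refine tsum_congr fun j => ?_
    simp only [hbdef]; push_cast
    rw [sub_mul, mul_assoc]
  rw [eq1] at q1 q2
  rw [ev, ef, hib]
  -- stability of the flux
  have st1 : |∑' j : ℤ, b (i - j) * F (j * h) - ∑' j, b (i - j) * fv j| ≤ (N1 + N2) * (L * E) := by
    have s1 := (sq_conv sb tb' (fun j : ℤ => b0 (j * h)) i).1
    have s2 := (sq_conv sb tb' (w := fv) (W := B + L * E) (fun j => by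
      have e1 := abs_sub_abs_le_abs_sub (fv j) (F (j * h))
      rw [abs_sub_comm] at e1
      linarith [hfv j, b0 (j * h)]) i).1
    have s3 := (sq_conv sb tb' hfv i).2
    rw [← s1.tsum_sub s2]
    simpa only [mul_sub] using s3
  have st2 : |∑' j : ℤ, d (i - j) * U0 (j * h) - ∑' j, d (i - j) * v j| ≤ 2 * (2 * N3) * E := by
    have s1 := (sq_conv sd td (fun j : ℤ => c0 (j * h)) i).1
    have s2 := (sq_conv sd td (w := v) (W := Mt + E) (fun j => by
      have e1 := abs_sub_abs_le_abs_sub (v j) (U0 (j * h))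
      rw [abs_sub_comm] at e1
      linarith [hv j, c0 (j * h)]) i).1
    have s3 := (sq_conv sd td hv i).2
    rw [← s1.tsum_sub s2]
    simpa only [mul_sub] using s3
  have st3 : |∑' j : ℤ, d (i - j) * U0 (j * h) - ∑' j : ℤ, b (i - j) * U2 (j * h)| ≤
      (N1 + N2) * (2 * Mt * h ^ 2) := by
    set δ : ℤ → ℝ := fun j => (U0 (j * h + h) - 2 * U0 (j * h) + U0 (j * h - h)) / h ^ 2 with hδ
    have f4 : ∀ j : ℤ, |δ j - U2 (j * h)| ≤ 2 * Mt * h ^ 2 := fun j =>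
      sq_fourth hU0 hU1 hU2 hU3 c4 hh (j * h)
    have e1 : ∑' j : ℤ, d (i - j) * U0 (j * h) = ∑' j, b (i - j) * δ j := by
      have := sq_sbp sb (w := fun j : ℤ => U0 (j * h)) (fun j => c0 _) i
      have l1 : ∑' j : ℤ, d (i - j) * U0 (j * h) = (∑' j : ℤ, (b (i - j + 1) - 2 * b (i - j) +
          b (i - j - 1)) * U0 (j * h)) / h ^ 2 := by
        rw [← tsum_div_const]
        refine tsum_congr fun j => ?_
        simp only [hddef, hbdef]; push_cast; ring
      rw [l1, this, ← tsum_div_const]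
      refine tsum_congr fun j => ?_
      simp only [hδ, hbdef]; push_cast
      ring_nf
    have s2 := (sq_conv sb tb' (fun j : ℤ => c2 (j * h)) i).1
    have s1 := (sq_conv sb tb' (w := δ) (W := Mt + 2 * Mt * h ^ 2) (fun j => by
      have e1 := abs_sub_abs_le_abs_sub (δ j) (U2 (j * h))
      linarith [f4 j, c2 (j * h)]) i).1
    have s3 := (sq_conv sb tb' f4 i).2
    rw [e1, ← s1.tsum_sub s2]
    simpa only [mul_sub] using s3
  set X1 := ∫ y, a1 (i * h - y) * F y
  set X2 := ∫ y, a1 (i * h - y) * U2 y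
  set Y1 := ∑' j : ℤ, b (i - j) * F (j * h)
  set Y2 := ∑' j : ℤ, b (i - j) * U2 (j * h)
  set Z1 := ∑' j, b (i - j) * fv j
  set Z2 := ∑' j, d (i - j) * v j
  set V2 := ∑' j : ℤ, d (i - j) * U0 (j * h)
  have k1 : |X1 - Z1| ≤ h ^ 2 * (B * (N3 + 2 * N2 + N1)) + (N1 + N2) * (L * E) := by
    have := abs_sub_le X1 Y1 Z1
    linarith
  have k2 : |X2 - Z2| ≤ h ^ 2 * (Mt * (N3 + 2 * N2 + N1)) + (N1 + N2) * (2 * Mt * h ^ 2) +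
      2 * (2 * N3) * E := by
    have t1 := abs_sub_le X2 Y2 Z2
    have t2 := abs_sub_le Y2 V2 Z2
    rw [abs_sub_comm Y2 V2] at t2
    linarith
  have k3 : (-X1 - κ * X2) - (-Z1 - κ * Z2) = -((X1 - Z1) + κ * (X2 - Z2)) := by ring
  rw [k3, abs_neg]
  refine (abs_add_le _ _).trans ?_
  rw [abs_mul, abs_of_pos hκ]
  have k4 := mul_le_mul_of_nonneg_left k2 hκ.le
  linarith

/-- **Quadratic convergence of the semi-discrete scheme** (Theorem 3.3, regular kernel case).
If `u` solves the continuous nonlocal equation `u_t = −α' ∗ f(u) − κ α''' ∗ u` on `[0,T]`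
with the stated smoothness, boundedness and integrability, then there is `C`, independent
of `h`, such that any solution `v` of the semi-discrete system on the grid `x_i = ih` with
initial data `v_i(0) = u(0, ih)` and a priori bound `‖v(t)‖_∞ ≤ 2M` satisfies
`sup_{t∈[0,T]} sup_i |u(t, ih) − v_i(t)| ≤ C h²`. -/
theorem semidiscrete_quadratic_convergence
    (α : ℝ → ℝ) (κ T : ℝ) (f : ℝ → ℝ) (u : ℝ → ℝ → ℝ) (Mtilde K M : ℝ)
    (hα : ContDiff ℝ 3 α)
    (hα0 : Integrable α) (hα1 : Integrable (deriv α))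
    (hα2 : Integrable (iteratedDeriv 2 α)) (hα3 : Integrable (iteratedDeriv 3 α))
    (hκ : 0 < κ) (hT : 0 < T)
    (hf : ContDiff ℝ 2 f) (hf0 : f 0 = 0)
    -- u(t,·) is four times differentiable in x, with u and its first four spatial
    -- derivatives bounded by Mtilde, uniformly on [0,T] × ℝ
    (hudiff : ∀ t ∈ Set.Icc (0 : ℝ) T, ∀ k < 4, Differentiable ℝ (iteratedDeriv k (u t)))
    (hub : ∀ t ∈ Set.Icc (0 : ℝ) T, ∀ k ≤ 4, ∀ x : ℝ, |iteratedDeriv k (u t) x| ≤ Mtilde)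
    -- u(t,·) and its first two spatial derivatives are integrable, uniformly in t
    (huint : ∀ t ∈ Set.Icc (0 : ℝ) T, ∀ k ≤ 2,
      Integrable (iteratedDeriv k (u t)) ∧ (∫ x : ℝ, |iteratedDeriv k (u t) x|) ≤ K)
    -- u solves the continuous nonlocal equation
    (hueq : ∀ t ∈ Set.Icc (0 : ℝ) T, ∀ x : ℝ,
      HasDerivAt (fun s => u s x)
        (-(∫ y : ℝ, deriv α (x - y) * f (u t y)) -
          κ * ∫ y : ℝ, iteratedDeriv 3 α (x - y) * u t y) t)
    -- M is the sup-norm bound on u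
    (hM : ∀ t ∈ Set.Icc (0 : ℝ) T, ∀ x : ℝ, |u t x| ≤ M) :
    ∃ C : ℝ, 0 < C ∧ ∀ h ∈ Set.Ioc (0 : ℝ) 1, ∀ v : ℝ → ℤ → ℝ,
      (∀ i : ℤ, v 0 i = u 0 (i * h)) →
      (∀ t ∈ Set.Icc (0 : ℝ) T, ∀ i : ℤ, |v t i| ≤ 2 * M) →
      (∀ i : ℤ, ∀ t ∈ Set.Icc (0 : ℝ) T,
        HasDerivAt (fun s => v s i)
          (-(∑' j : ℤ, h * deriv α (((i - j : ℤ) : ℝ) * h) * f (v t j)) -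
            κ * ∑' j : ℤ, h * ((deriv α (((i - j + 1 : ℤ) : ℝ) * h) -
              2 * deriv α (((i - j : ℤ) : ℝ) * h) +
              deriv α (((i - j - 1 : ℤ) : ℝ) * h)) / h ^ 2) * v t j) t) →
      ∀ t ∈ Set.Icc (0 : ℝ) T, ∀ i : ℤ, |u t (i * h) - v t i| ≤ C * h ^ 2 := by
  have hM0 : 0 ≤ M := (abs_nonneg _).trans (hM 0 ⟨le_rfl, hT.le⟩ 0)
  have hMt0 : 0 ≤ Mtilde := (abs_nonneg _).trans (hub 0 ⟨le_rfl, hT.le⟩ 0 (by norm_num) 0)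
  -- derivatives of the kernel
  have a12 : ∀ x, HasDerivAt (deriv α) (iteratedDeriv 2 α x) x := fun x => by
    have := (hα.differentiable_iteratedDeriv 1 (by norm_num)) x
    rw [iteratedDeriv_succ]
    simpa [iteratedDeriv_one] using this.hasDerivAt
  have a23 : ∀ x, HasDerivAt (iteratedDeriv 2 α) (iteratedDeriv 3 α x) x := fun x => by
    have := (hα.differentiable_iteratedDeriv 2 (by norm_num)) x
    rw [iteratedDeriv_succ (n := 2)]
    exact this.hasDerivAt
  -- derivatives of f
  have f01 : ∀ x, HasDerivAt f (deriv f x) x := fun x =>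
    (hf.differentiable (by norm_num) x).hasDerivAt
  have f12 : ∀ x, HasDerivAt (deriv f) (deriv (deriv f) x) x := fun x => by
    have := (hf.differentiable_iteratedDeriv 1 (by norm_num)) x
    rw [iteratedDeriv_one] at this
    exact this.hasDerivAt
  have f2c : Continuous (deriv (deriv f)) := by
    have := hf.continuous_iteratedDeriv 2 le_rfl
    rwa [iteratedDeriv_succ, iteratedDeriv_one] at this
  obtain ⟨L0, hL0⟩ := (isCompact_Icc (a := -(2 * M)) (b := 2 * M)).exists_bound_of_continuousOn
    (sq_cont f01).continuousOn
  obtain ⟨L1, hL1⟩ := (isCompact_Icc (a := -(2 * M)) (b := 2 * M)).exists_bound_of_continuousOn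
    (sq_cont f12).continuousOn
  obtain ⟨L2, hL2⟩ := (isCompact_Icc (a := -(2 * M)) (b := 2 * M)).exists_bound_of_continuousOn
    f2c.continuousOn
  simp only [Real.norm_eq_abs] at hL0 hL1 hL2
  have z0 : (0 : ℝ) ∈ Set.Icc (-(2 * M)) (2 * M) := ⟨by linarith, by linarith⟩
  have L0p : 0 ≤ L0 := (abs_nonneg _).trans (hL0 0 z0)
  have L1p : 0 ≤ L1 := (abs_nonneg _).trans (hL1 0 z0)
  have L2p : 0 ≤ L2 := (abs_nonneg _).trans (hL2 0 z0)
  set N1 := ∫ y, |deriv α y| with hN1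
  set N2 := ∫ y, |iteratedDeriv 2 α y| with hN2
  set N3 := ∫ y, |iteratedDeriv 3 α y| with hN3
  have N1p : 0 ≤ N1 := integral_nonneg fun _ => abs_nonneg _
  have N2p : 0 ≤ N2 := integral_nonneg fun _ => abs_nonneg _
  have N3p : 0 ≤ N3 := integral_nonneg fun _ => abs_nonneg _
  set B := L0 + L1 * Mtilde + (L2 * Mtilde * Mtilde + L1 * Mtilde) with hB
  have Bp : 0 ≤ B := by positivity
  set G := (N1 + N2) * L1 + κ * (4 * N3) with hG
  have Gp : 0 ≤ G := by positivity
  set Cc := B * (N3 + 2 * N2 + N1) + κ * (Mtilde * (N3 + 2 * N2 + N1) +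
    (N1 + N2) * (2 * Mtilde)) with hCc
  have Cp : 0 ≤ Cc := by positivity
  refine ⟨2 * Cc * T * Real.exp (2 * (G + 1) * T) + 1, by positivity, ?_⟩
  intro h hh v hv0 hvb hveq t ht i
  have hhp : 0 < h := hh.1
  have main := sq_gronwall (e := fun t i => u t (i * h) - v t i)
    (e' := fun t i => (-(∫ y : ℝ, deriv α (i * h - y) * f (u t y)) -
          κ * ∫ y : ℝ, iteratedDeriv 3 α (i * h - y) * u t y) -
          (-(∑' j : ℤ, h * deriv α (((i - j : ℤ) : ℝ) * h) * f (v t j)) -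
            κ * ∑' j : ℤ, h * ((deriv α (((i - j + 1 : ℤ) : ℝ) * h) -
              2 * deriv α (((i - j : ℤ) : ℝ) * h) +
              deriv α (((i - j - 1 : ℤ) : ℝ) * h)) / h ^ 2) * v t j))
    (B := G + 1) (D := Cc * h ^ 2) (T := T) (W := M + 2 * M) (by linarith) (by positivity)
    (fun i t ht => (hueq t ht (i * h)).sub (hveq i t ht))
    (fun i => by simp [hv0])
    (fun t ht i => (abs_sub _ _).trans (add_le_add (hM t ht _) (hvb t ht i)))
    (by
      intro t ht E hE i
      have E0 : 0 ≤ E := (abs_nonneg _).trans (hE 0)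
      have Ud : ∀ k < 4, ∀ x, HasDerivAt (iteratedDeriv k (u t)) (iteratedDeriv (k + 1) (u t) x) x := by
        intro k hk x
        rw [iteratedDeriv_succ]
        exact (hudiff t ht k hk x).hasDerivAt
      have U0 := Ud 0 (by norm_num)
      rw [iteratedDeriv_zero] at U0
      have c0 := hub t ht 0 (by norm_num)
      rw [iteratedDeriv_zero] at c0
      have um : ∀ x, u t x ∈ Set.Icc (-(2 * M)) (2 * M) := fun x => by
        have := abs_le.1 (hM t ht x)
        constructor <;> linarith [this.1, this.2]
      have c1 := hub t ht 1 (by norm_num)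
      have c2 := hub t ht 2 (by norm_num)
      have p1 : ∀ x, |deriv f (u t x) * iteratedDeriv 1 (u t) x| ≤ L1 * Mtilde := fun x => by
        rw [abs_mul]
        exact mul_le_mul (hL1 _ (um x)) (c1 x) (abs_nonneg _) L1p
      have p2 : ∀ x, |deriv f (u t x) * iteratedDeriv 2 (u t) x| ≤ L1 * Mtilde := fun x => by
        rw [abs_mul]
        exact mul_le_mul (hL1 _ (um x)) (c2 x) (abs_nonneg _) L1p
      have p3 : ∀ x, |deriv (deriv f) (u t x) * iteratedDeriv 1 (u t) x * iteratedDeriv 1 (u t) x|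
          ≤ L2 * Mtilde * Mtilde := fun x => by
        rw [abs_mul, abs_mul]
        exact mul_le_mul (mul_le_mul (hL2 _ (um x)) (c1 x) (abs_nonneg _) L2p) (c1 x)
          (abs_nonneg _) (by positivity)
      have q1 : 0 ≤ L1 * Mtilde := by positivity
      have q2 : 0 ≤ L2 * Mtilde * Mtilde := by positivity
      have lip : ∀ j : ℤ, |f (u t (j * h)) - f (v t j)| ≤ L1 * E := fun j => by
        have vm : v t j ∈ Set.Icc (-(2 * M)) (2 * M) := abs_le.1 (hvb t ht j)
        have := Convex.norm_image_sub_le_of_norm_hasDerivWithin_le (𝕜 := ℝ)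
          (fun x _ => (f01 x).hasDerivWithinAt) hL1 (convex_Icc _ _) vm (um (j * h))
        exact this.trans (mul_le_mul_of_nonneg_left (hE j) L1p)
      have r := sq_rate (F := fun y => f (u t y))
        (F1 := fun y => deriv f (u t y) * iteratedDeriv 1 (u t) y)
        (F2 := fun y => deriv (deriv f) (u t y) * iteratedDeriv 1 (u t) y * iteratedDeriv 1 (u t) y
          + deriv f (u t y) * iteratedDeriv 2 (u t) y) (B := B)
        a12 a23 hα1 hα2 hα3
        (fun x => (f01 (u t x)).comp x (U0 x))
        (fun x => ((f12 (u t x)).comp x (U0 x)).mul (Ud 1 (by norm_num) x))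
        (fun x => (hL0 _ (um x)).trans (by linarith))
        (fun x => (p1 x).trans (by linarith))
        (fun x => (abs_add_le _ _).trans (by linarith [p2 x, p3 x]))
        U0 (Ud 1 (by norm_num)) (Ud 2 (by norm_num)) (Ud 3 (by norm_num))
        c0 c1 c2 (hub t ht 3 (by norm_num)) (hub t ht 4 (by norm_num))
        hκ hhp hh.2 i (v t) (fun j => f (v t j)) hE lip
      refine r.trans ?_
      linarith) t ht i
  refine main.trans ?_
  have : 0 ≤ h ^ 2 := by positivity
  linarith
end

section
/- Let α : ℝ → ℝ be three times continuously differentiable with α, α′, α″, α‴ integrable, let κ > 0, T > 0, and let f : ℝ → ℝ be twice continuously differentiable with f(0) = 0. Let u : [0, T] × ℝ → ℝ satisfy the hypotheses of the discretization theorem (u and its first four spatial derivatives bounded by M̃, u(t,·) together with its first two spatial derivatives integrable uniformly in t, and ∂_t u = −α′ ∗ f(u) − κ·α‴ ∗ u), and assume in addition that u(t, x) → 0 as |x| → ∞ uniformly in t ∈ [0, T]. Then there exist C > 0 and h₀ > 0 such that for every h ∈ (0, h₀] and every ε > 0 there is an N ∈ ℕ with the property that the truncated system d v_i/dt = −Σ_{j=−N}^{N}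 h·α′((i−j)h) f(v_j) − κ·Σ_{j=−N}^{N} h·[(α′((i−j+1)h) − 2α′((i−j)h) + α′((i−j−1)h))/h²]·v_j, −N ≤ i ≤ N, with initial data v_i(0) = u(0, ih), has a solution v on [0, T] and max_{|i| ≤ N} |u(t, ih) − v_i(t)| ≤ C·(h² + ε) for all t ∈ [0, T]. -/
open MeasureTheory

lemma osc_bound {g g' : ℝ → ℝ} (hg : ∀ x, HasDerivAt g (g' x) x) (hi : Integrable g')
    {a b x y : ℝ} (hab : a ≤ b) (hx : x ∈ Set.Icc a b) (hy : y ∈ Set.Icc a b) :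
    |g x - g y| ≤ ∫ s in a..b, |g' s| := by
  rw [← intervalIntegral.integral_eq_sub_of_hasDerivAt (fun s _ => hg s) hi.intervalIntegrable]
  have h1 := intervalIntegral.norm_integral_le_integral_norm_uIoc (f := g') (μ := volume)
    (a := y) (b := x)
  rw [Real.norm_eq_abs] at h1
  refine h1.trans ?_
  rw [intervalIntegral.integral_of_le hab]
  apply setIntegral_mono_set
  · exact hi.abs.integrableOn
  · exact Filter.Eventually.of_forall fun _ => abs_nonneg _
  · apply Filter.Eventually.of_forall
    intro s hs
    replace hs : s ∈ Set.uIoc y x := hs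
    rw [Set.mem_uIoc] at hs
    show s ∈ Set.Ioc a b
    rcases hs with hs | hs
    · exact ⟨lt_of_le_of_lt hy.1 hs.1, hs.2.trans hx.2⟩
    · exact ⟨lt_of_le_of_lt hx.1 hs.1, hs.2.trans hy.2⟩

lemma cell1 {g g' : ℝ → ℝ} (hg : ∀ x, HasDerivAt g (g' x) x) (hi0 : Integrable g)
    (hi : Integrable g') {a c : ℝ} (hc : c ∈ Set.Icc a (a+1)) :
    |g c| ≤ (∫ s in a..a+1, |g s|) + ∫ s in a..a+1, |g' s| := by
  have h1 : ∫ s in a..a+1, |g c| ≤ ∫ s in a..a+1, (|g s| + ∫ s in a..a+1, |g' s|) := by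
    apply intervalIntegral.integral_mono_on (by linarith) (by simp)
    · exact (hi0.abs.intervalIntegrable).add (by simp)
    · intro s hs
      have := osc_bound hg hi (by linarith) hc hs
      have := abs_sub_abs_le_abs_sub (g c) (g s)
      linarith
  rw [intervalIntegral.integral_add hi0.abs.intervalIntegrable (by simp)] at h1
  simpa using h1

lemma taylor1 {g g' g'' : ℝ → ℝ} (hg : ∀ x, HasDerivAt g (g' x) x)
    (hg' : ∀ x, HasDerivAt g' (g'' x) x) (hi : Integrable g'')
    {a b c s : ℝ} (hab : a ≤ b) (hc : c ∈ Set.Icc a b) (hs : s ∈ Set.Icc a b) :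
    |g s - g c - (s - c) * g' c| ≤ (∫ s in a..b, |g'' s|) * |s - c| := by
  have := Convex.norm_image_sub_le_of_norm_hasDerivWithin_le (f := fun s => g s - (s - c) * g' c)
    (f' := fun s => g' s - g' c) (s := Set.Icc a b) (C := ∫ s in a..b, |g'' s|) (x := c) (y := s)
    (fun x hx => ?_) (fun x hx => osc_bound hg' hi hab hx hc) (convex_Icc a b) hc hs
  · simpa [Real.norm_eq_abs, sub_right_comm] using this
  · have := (hg x).sub (((hasDerivAt_id x).sub_const c).mul_const (g' c))
    simp only [id, one_mul] at this
    exact this.hasDerivWithinAt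

lemma cell2 {g g' g'' : ℝ → ℝ} (hg : ∀ x, HasDerivAt g (g' x) x)
    (hg' : ∀ x, HasDerivAt g' (g'' x) x) (hi0 : Integrable g) (hi : Integrable g'') (c : ℝ) :
    |(∫ s in c - 1/2..c - 1/2+1, g s) - g c| ≤ ∫ s in c - 1/2..c-1/2+1, |g'' s| := by
  set I := ∫ s in c - 1/2..c-1/2+1, |g'' s| with hI
  have hI0 : 0 ≤ I := intervalIntegral.integral_nonneg (by linarith) fun _ _ => abs_nonneg _
  have e : (∫ s in c - 1/2..c - 1/2+1, g s) - g c
      = ∫ s in c - 1/2..c - 1/2+1, (g s - g c - (s - c) * g' c) := by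
    rw [intervalIntegral.integral_sub, intervalIntegral.integral_sub]
    · simp
      ring_nf
    · exact hi0.intervalIntegrable
    · simp
    · exact hi0.intervalIntegrable.sub (by simp)
    · apply Continuous.intervalIntegrable; fun_prop
  rw [e]
  have := intervalIntegral.norm_integral_le_of_norm_le_const (a := c - 1/2) (b := c-1/2+1) (C := I)
    (f := fun s => g s - g c - (s - c) * g' c) ?_
  · simpa using this
  · intro x hx
    rw [Set.uIoc_of_le (by linarith)] at hx
    refine (taylor1 hg hg' hi (by linarith) (c := c) ⟨by linarith, by linarith⟩
      ⟨hx.1.le, hx.2⟩).trans ?_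
    have : |x - c| ≤ 1 := by rw [abs_le]; constructor <;> linarith [hx.1, hx.2]
    nlinarith

lemma cell3 {g g' g'' : ℝ → ℝ} (hg : ∀ x, HasDerivAt g (g' x) x)
    (hg' : ∀ x, HasDerivAt g' (g'' x) x) (hi : Integrable g'') (c : ℝ) :
    |g (c+1) - 2 * g c + g (c-1)| ≤ (∫ s in (c-1)..c, |g'' s|) + ∫ s in c..c+1, |g'' s| := by
  rw [intervalIntegral.integral_add_adjacent_intervals hi.abs.intervalIntegrable
    hi.abs.intervalIntegrable]
  have hc : Continuous g := continuous_iff_continuousAt.2 fun x => (hg x).continuousAt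
  obtain ⟨x, hx, hx'⟩ := exists_hasDerivAt_eq_slope g g' (show c - 1 < c by linarith)
    hc.continuousOn (fun x _ => hg x)
  obtain ⟨y, hy, hy'⟩ := exists_hasDerivAt_eq_slope g g' (show c < c+1 by linarith)
    hc.continuousOn (fun x _ => hg x)
  have := osc_bound hg' hi (show c - 1 ≤ c + 1 by linarith) (x := y) (y := x)
    ⟨by linarith [hy.1], hy.2.le⟩ ⟨hx.1.le, by linarith [hx.2]⟩
  rw [hx', hy'] at this
  convert this using 2
  simp
  ring

lemma sum1 {g g' : ℝ → ℝ} (hg : ∀ x, HasDerivAt g (g' x) x) (hi0 : Integrable g)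
    (hi : Integrable g') :
    Summable (fun j : ℤ => |g j|) ∧ ∑' j : ℤ, |g j| ≤ (∫ s, |g s|) + ∫ s, |g' s| := by
  have h1 := (hi0.abs.hasSum_intervalIntegral 0).add (hi.abs.hasSum_intervalIntegral 0)
  have hb : ∀ j : ℤ, |g j| ≤ (∫ s in (0:ℝ)+j..0+j+1, |g s|) + ∫ s in (0:ℝ)+j..0+j+1, |g' s| :=
    fun j => cell1 hg hi0 hi ⟨by simp, by simp⟩
  have hs : Summable (fun j : ℤ => |g j|) :=
    Summable.of_nonneg_of_le (fun _ => abs_nonneg _) hb h1.summable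
  exact ⟨hs, hasSum_le hb hs.hasSum h1⟩

lemma sum2 {g g' g'' : ℝ → ℝ} (hg : ∀ x, HasDerivAt g (g' x) x)
    (hg' : ∀ x, HasDerivAt g' (g'' x) x) (hi0 : Integrable g) (hi1 : Integrable g')
    (hi : Integrable g'') :
    |(∫ s, g s) - ∑' j : ℤ, g j| ≤ ∫ s, |g'' s| := by
  have hs := (sum1 hg hi0 hi1).1.of_abs.hasSum
  have h1 := ((hi0.hasSum_intervalIntegral (-(1/2))).sub hs)
  have h2 := hi.abs.hasSum_intervalIntegral (-(1/2))
  rw [abs_le]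
  have key : ∀ j : ℤ, |(∫ s in (-(1/2):ℝ)+j..-(1/2)+j+1, g s) - g j|
      ≤ ∫ s in (-(1/2):ℝ)+j..-(1/2)+j+1, |g'' s| := by
    intro j
    have := cell2 hg hg' hi0 hi j
    rwa [show (j:ℝ) - 1/2 = -(1/2)+j by ring] at this
  constructor
  · exact hasSum_le (fun j => (abs_le.1 (key j)).1) h2.neg h1
  · exact hasSum_le (fun j => (abs_le.1 (key j)).2) h1 h2

lemma sum3 {g g' g'' : ℝ → ℝ} (hg : ∀ x, HasDerivAt g (g' x) x)
    (hg' : ∀ x, HasDerivAt g' (g'' x) x) (hi : Integrable g'') :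
    Summable (fun j : ℤ => |g (j+1) - 2 * g j + g (j-1)|) ∧
    ∑' j : ℤ, |g (j+1) - 2 * g j + g (j-1)| ≤ 2 * ∫ s, |g'' s| := by
  have h1 := (hi.abs.hasSum_intervalIntegral (-1)).add (hi.abs.hasSum_intervalIntegral 0)
  have hb : ∀ j : ℤ, |g (j+1) - 2 * g j + g (j-1)| ≤
      (∫ s in (-1:ℝ)+j..-1+j+1, |g'' s|) + ∫ s in (0:ℝ)+j..0+j+1, |g'' s| := by
    intro j
    have := cell3 hg hg' hi j
    convert this using 4 <;> ring
  have hs : Summable (fun j : ℤ => |g (j+1) - 2 * g j + g (j-1)|) :=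
    Summable.of_nonneg_of_le (fun _ => abs_nonneg _) hb h1.summable
  refine ⟨hs, (hasSum_le hb hs.hasSum h1).trans (by linarith)⟩

lemma hscale {g g' : ℝ → ℝ} (hg : ∀ x, HasDerivAt g (g' x) x) (h : ℝ) (s : ℝ) :
    HasDerivAt (fun s => g (s * h)) (h * g' (s * h)) s := by
  have := (hg (s * h)).comp s ((hasDerivAt_id s).mul_const h)
  simpa [Function.comp_def, mul_comm] using this

lemma iscale (g : ℝ → ℝ) {h : ℝ} (hh : 0 < h) : ∫ s, g (s * h) = h⁻¹ * ∫ s, g s := by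
  rw [Measure.integral_comp_mul_right, abs_of_pos (inv_pos.2 hh), smul_eq_mul]

lemma sum1h {g g' : ℝ → ℝ} (hg : ∀ x, HasDerivAt g (g' x) x) (hi0 : Integrable g)
    (hi : Integrable g') {h : ℝ} (hh : 0 < h) :
    Summable (fun j : ℤ => |g (j * h)|) ∧
      h * ∑' j : ℤ, |g (j * h)| ≤ (∫ s, |g s|) + h * ∫ s, |g' s| := by
  obtain ⟨h1, h2⟩ := sum1 (hscale hg h) (hi0.comp_mul_right' hh.ne')
    ((hi.comp_mul_right' hh.ne').const_mul h)
  refine ⟨h1, ?_⟩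
  rw [iscale (fun s => |g s|) hh] at h2
  simp_rw [abs_mul, abs_of_pos hh] at h2
  rw [integral_const_mul, iscale (fun s => |g' s|) hh] at h2
  calc _ ≤ _ := mul_le_mul_of_nonneg_left h2 hh.le
    _ = _ := by field_simp

lemma sum2h {g g' g'' : ℝ → ℝ} (hg : ∀ x, HasDerivAt g (g' x) x)
    (hg' : ∀ x, HasDerivAt g' (g'' x) x) (hi0 : Integrable g) (hi1 : Integrable g')
    (hi : Integrable g'') {h : ℝ} (hh : 0 < h) :
    |(∫ s, g s) - h * ∑' j : ℤ, g (j * h)| ≤ h^2 * ∫ s, |g'' s| := by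
  have h2 := sum2 (hscale hg h) (fun s => (hscale hg' h s).const_mul h)
    (hi0.comp_mul_right' hh.ne')
    ((hi1.comp_mul_right' hh.ne').const_mul h)
    (((hi.comp_mul_right' hh.ne').const_mul h).const_mul h)
  rw [iscale g hh] at h2
  simp_rw [abs_mul, abs_of_pos hh] at h2
  rw [integral_const_mul, integral_const_mul, iscale (fun s => |g'' s|) hh] at h2
  calc _ = h * |h⁻¹ * (∫ s, g s) - ∑' j : ℤ, g (j * h)| := by
        rw [← abs_of_pos hh, ← abs_mul, abs_of_pos hh, mul_sub, mul_inv_cancel_left₀ hh.ne']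
    _ ≤ _ := mul_le_mul_of_nonneg_left h2 hh.le
    _ = _ := by field_simp

lemma sum3h {g g' g'' : ℝ → ℝ} (hg : ∀ x, HasDerivAt g (g' x) x)
    (hg' : ∀ x, HasDerivAt g' (g'' x) x) (hi : Integrable g'') {h : ℝ} (hh : 0 < h) :
    Summable (fun j : ℤ => |g ((j+1) * h) - 2 * g (j * h) + g ((j-1) * h)|) ∧
    ∑' j : ℤ, |g ((j+1) * h) - 2 * g (j * h) + g ((j-1) * h)| ≤ 2 * h * ∫ s, |g'' s| := by
  obtain ⟨h1, h2⟩ := sum3 (hscale hg h) (fun s => (hscale hg' h s).const_mul h)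
    (((hi.comp_mul_right' hh.ne').const_mul h).const_mul h)
  refine ⟨h1, h2.trans ?_⟩
  simp_rw [abs_mul, abs_of_pos hh]
  rw [integral_const_mul, integral_const_mul, iscale (fun s => |g'' s|) hh]
  apply le_of_eq
  field_simp

lemma flip_deriv {β β1 : ℝ → ℝ} (hb : ∀ x, HasDerivAt β (β1 x) x) (x y : ℝ) :
    HasDerivAt (fun y => β (x - y)) (-β1 (x - y)) y := by
  have := (hb (x - y)).comp y ((hasDerivAt_id y).const_sub x)
  simpa [Function.comp_def] using this

lemma convA {β β1 : ℝ → ℝ} (hb : ∀ x, HasDerivAt β (β1 x) x)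
    (hi0 : Integrable β) (hi1 : Integrable β1) {h : ℝ} (hh : 0 < h) (x : ℝ) :
    Summable (fun j : ℤ => |β (x - j * h)|) ∧
      h * ∑' j : ℤ, |β (x - j * h)| ≤ (∫ s, |β s|) + h * ∫ s, |β1 s| := by
  have := sum1h (flip_deriv hb x) (hi0.comp_sub_left x) (hi1.comp_sub_left x).neg hh
  simp only [abs_neg] at this
  rwa [integral_sub_left_eq_self (fun s => |β s|), integral_sub_left_eq_self (fun s => |β1 s|)]
    at this

lemma convD {β β1 β2 : ℝ → ℝ} (hb : ∀ x, HasDerivAt β (β1 x) x)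
    (hb1 : ∀ x, HasDerivAt β1 (β2 x) x)
    (hi2 : Integrable β2) {h : ℝ} (hh : 0 < h) (x : ℝ) :
    Summable (fun j : ℤ => |β (x - (j - 1) * h) - 2 * β (x - j * h) + β (x - (j + 1) * h)|) ∧
      ∑' j : ℤ, |β (x - (j - 1) * h) - 2 * β (x - j * h) + β (x - (j + 1) * h)|
        ≤ 2 * h * ∫ s, |β2 s| := by
  have := sum3h (g'' := fun y => β2 (x - y)) (flip_deriv hb x)
    (fun y => (flip_deriv hb1 x y).neg.congr_deriv (by simp)) (hi2.comp_sub_left x) hh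
  rw [integral_sub_left_eq_self (fun s => |β2 s|)] at this
  have e : ∀ j : ℤ, |β (x - (j - 1) * h) - 2 * β (x - j * h) + β (x - (j + 1) * h)|
     = |β (x - (j + 1) * h) - 2 * β (x - j * h) + β (x - (j - 1) * h)| := by
    intro j; congr 1; ring
  simpa only [e] using this

lemma int_mul_bdd {a w : ℝ → ℝ} {W : ℝ} (ha : Integrable a) (hw : Measurable w)
    (hW : ∀ x, |w x| ≤ W) : Integrable (fun y => a y * w y) :=
  ha.mul_bdd hw.aestronglyMeasurable (Filter.Eventually.of_forall hW)

lemma norm_mul_bdd {a w : ℝ → ℝ} {W : ℝ} (ha : Integrable a) (hw : Measurable w)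
    (hW : ∀ x, |w x| ≤ W) : ∫ y, |a y * w y| ≤ W * ∫ y, |a y| := by
  rw [← integral_const_mul]
  apply integral_mono (int_mul_bdd ha hw hW).abs (ha.abs.const_mul W)
  intro y
  simp only [abs_mul]
  rw [mul_comm]
  exact mul_le_mul_of_nonneg_right (hW y) (abs_nonneg _)

lemma meas_of_deriv {g g' : ℝ → ℝ} (hg : ∀ x, HasDerivAt g (g' x) x) :
    Measurable g ∧ Measurable g' := by
  constructor
  · exact (continuous_iff_continuousAt.2 fun x => (hg x).continuousAt).measurable
  · have : g' = deriv g := funext fun x => (hg x).deriv.symm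
    rw [this]; exact measurable_deriv g

lemma convQ {β β1 β2 w w1 w2 : ℝ → ℝ} (hb : ∀ x, HasDerivAt β (β1 x) x)
    (hb1 : ∀ x, HasDerivAt β1 (β2 x) x)
    (hi0 : Integrable β) (hi1 : Integrable β1) (hi2 : Integrable β2)
    (hw : ∀ x, HasDerivAt w (w1 x) x) (hw1 : ∀ x, HasDerivAt w1 (w2 x) x) {W : ℝ}
    (hW : ∀ x, |w x| ≤ W) (hW1 : ∀ x, |w1 x| ≤ W) (hW2 : ∀ x, |w2 x| ≤ W)
    {h : ℝ} (hh : 0 < h) (x : ℝ) :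
    |(∫ y, β (x - y) * w y) - h * ∑' j : ℤ, β (x - j * h) * w (j * h)| ≤
      h ^ 2 * (W * ((∫ s, |β2 s|) + 2 * (∫ s, |β1 s|) + ∫ s, |β s|)) := by
  have m := (meas_of_deriv hw).1
  have m1 := (meas_of_deriv hw).2
  have m2 := (meas_of_deriv hw1).2
  have j0 := hi0.comp_sub_left x
  have j1 := hi1.comp_sub_left x
  have j2 := hi2.comp_sub_left x
  have key := sum2h (g := fun y => β (x - y) * w y)
    (g' := fun y => -(β1 (x - y) * w y) + β (x - y) * w1 y)
    (g'' := fun y => β2 (x - y) * w y - 2 * (β1 (x - y) * w1 y) + β (x - y) * w2 y)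
    (fun y => by
      have := (flip_deriv hb x y).mul (hw y)
      rw [neg_mul] at this; exact this)
    (fun y => by
      have := ((flip_deriv hb1 x y).mul (hw y)).neg.add ((flip_deriv hb x y).mul (hw1 y))
      exact this.congr_deriv (by ring))
    (int_mul_bdd j0 m hW) ((int_mul_bdd j1 m hW).neg.add (int_mul_bdd j0 m1 hW1))
    (((int_mul_bdd j2 m hW).sub ((int_mul_bdd j1 m1 hW1).const_mul 2)).add
      (int_mul_bdd j0 m2 hW2)) hh
  refine key.trans (mul_le_mul_of_nonneg_left ?_ (by positivity))
  have a0 := norm_mul_bdd j0 m2 hW2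
  have a1 := norm_mul_bdd j1 m1 hW1
  have a2 := norm_mul_bdd j2 m hW
  rw [integral_sub_left_eq_self (fun s => |β s|)] at a0
  rw [integral_sub_left_eq_self (fun s => |β1 s|)] at a1
  rw [integral_sub_left_eq_self (fun s => |β2 s|)] at a2
  have i2 := (int_mul_bdd j2 m hW).abs
  have i1 := (int_mul_bdd j1 m1 hW1).abs.const_mul 2
  have i0 := (int_mul_bdd j0 m2 hW2).abs
  calc _ ≤ ∫ y, (|β2 (x - y) * w y| + 2 * |β1 (x - y) * w1 y| + |β (x - y) * w2 y|) := by
        apply integral_mono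
        · exact (((int_mul_bdd j2 m hW).sub ((int_mul_bdd j1 m1 hW1).const_mul 2)).add
            (int_mul_bdd j0 m2 hW2)).abs
        · exact (i2.add i1).add i0
        · intro y
          refine (abs_add_le _ _).trans ?_
          have h3 := abs_sub (β2 (x - y) * w y) (2 * (β1 (x - y) * w1 y))
          rw [abs_mul 2, abs_two] at h3
          exact add_le_add_left h3 _
    _ = (∫ y, |β2 (x - y) * w y|) + 2 * (∫ y, |β1 (x - y) * w1 y|) + ∫ y, |β (x - y) * w2 y| := by
        have i21 : Integrable (fun y => |β2 (x - y) * w y| + 2 * |β1 (x - y) * w1 y|) := i2.add i1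
        rw [integral_add i21 i0, integral_add i2 i1, integral_const_mul]
    _ ≤ _ := by linarith

lemma ibp1 {β β1 w w1 : ℝ → ℝ} (hb : ∀ x, HasDerivAt β (β1 x) x)
    (hi0 : Integrable β) (hi1 : Integrable β1)
    (hw : ∀ x, HasDerivAt w (w1 x) x) {W : ℝ}
    (hW : ∀ x, |w x| ≤ W) (hW1 : ∀ x, |w1 x| ≤ W) (x : ℝ) :
    ∫ y, β1 (x - y) * w y = ∫ y, β (x - y) * w1 y := by
  have m := (meas_of_deriv hw).1
  have m1 := (meas_of_deriv hw).2
  have j0 := hi0.comp_sub_left x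
  have j1 := hi1.comp_sub_left x
  have := integral_mul_deriv_eq_deriv_mul_of_integrable (u := fun y => β (x - y)) (v := w)
    (u' := fun y => - β1 (x - y)) (v' := w1) (fun y _ => flip_deriv hb x y) (fun y _ => hw y)
    (int_mul_bdd j0 m1 hW1) (int_mul_bdd j1.neg m hW) (int_mul_bdd j0 m hW)
  rw [this]
  simp [integral_neg]

lemma mv0 {φ φ' : ℝ → ℝ} (hφ : ∀ x, HasDerivAt φ (φ' x) x) (h0 : φ 0 = 0) {h B : ℝ}
    (hB : ∀ s ∈ Set.Icc 0 h, |φ' s| ≤ B) : ∀ s ∈ Set.Icc 0 h, |φ s| ≤ B * h := by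
  intro s hs
  have := Convex.norm_image_sub_le_of_norm_hasDerivWithin_le (f := φ)
    (f' := φ') (s := Set.Icc 0 h) (C := B) (x := 0) (y := s)
    (fun x hx => (hφ x).hasDerivWithinAt) hB (convex_Icc 0 h) ⟨le_rfl, hs.1.trans hs.2⟩ hs
  rw [h0, sub_zero, sub_zero, Real.norm_eq_abs, Real.norm_eq_abs, abs_of_nonneg hs.1] at this
  refine this.trans (mul_le_mul_of_nonneg_left hs.2 ((abs_nonneg _).trans (hB s hs)))

lemma d2err {u u1 u2 u3 u4 : ℝ → ℝ} (h1 : ∀ x, HasDerivAt u (u1 x) x)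
    (h2 : ∀ x, HasDerivAt u1 (u2 x) x) (h3 : ∀ x, HasDerivAt u2 (u3 x) x)
    (h4 : ∀ x, HasDerivAt u3 (u4 x) x) {M : ℝ} (hM : ∀ x, |u4 x| ≤ M) {h : ℝ} (hh : 0 < h)
    (x : ℝ) : |(u (x + h) - 2 * u x + u (x - h)) / h ^ 2 - u2 x| ≤ 2 * M * h ^ 2 := by
  have dp : ∀ {g g' : ℝ → ℝ}, (∀ x, HasDerivAt g (g' x) x) → ∀ s,
      HasDerivAt (fun s => g (x + s)) (g' (x + s)) s := by
    intro g g' hg s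
    simpa using (hg (x + s)).comp_const_add x s
  have dm : ∀ {g g' : ℝ → ℝ}, (∀ x, HasDerivAt g (g' x) x) → ∀ s,
      HasDerivAt (fun s => g (x - s)) (-g' (x - s)) s := fun hg s => flip_deriv hg x s
  have e4 : ∀ s ∈ Set.Icc 0 h, |u4 (x + s) + u4 (x - s)| ≤ 2 * M := by
    intro s _
    have := abs_add_le (u4 (x + s)) (u4 (x - s))
    linarith [hM (x + s), hM (x - s)]
  have e3 := mv0 (φ := fun s => u3 (x + s) - u3 (x - s)) (fun s => 
    ((dp h4 s).sub (dm h4 s)).congr_deriv (sub_neg_eq_add _ _)) (by simp) e4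
  have e2 := mv0 (φ := fun s => u2 (x + s) + u2 (x - s) - 2 * u2 x) (fun s => by
    simpa [sub_eq_add_neg] using ((dp h3 s).add (dm h3 s)).sub_const (2 * u2 x))
    (by simp; ring) e3
  have e1 := mv0 (φ := fun s => u1 (x + s) - u1 (x - s) - 2 * u2 x * s) (fun s => 
    (((dp h2 s).sub (dm h2 s)).sub ((hasDerivAt_id s).const_mul (2 * u2 x))).congr_deriv
      (by simp))
    (by simp) e2
  have e0 := mv0 (φ := fun s => u (x + s) + u (x - s) - 2 * u x - u2 x * s ^ 2) (fun s => by
    have := (((dp h1 s).add (dm h1 s)).sub_const (2 * u x)).sub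
      (((hasDerivAt_id s).pow 2).const_mul (u2 x))
    exact this.congr_deriv (by simp; ring)) (by simp; ring) e1 h ⟨hh.le, le_rfl⟩
  have : (u (x + h) - 2 * u x + u (x - h)) / h ^ 2 - u2 x
    = (u (x + h) + u (x - h) - 2 * u x - u2 x * h ^ 2) / h ^ 2 := by field_simp; ring
  rw [this, abs_div, abs_of_pos (pow_pos hh 2), div_le_iff₀ (by positivity)]
  calc _ ≤ _ := e0
    _ = _ := by ring

lemma sum_mul_bdd {a w : ℤ → ℝ} {W : ℝ} (ha : Summable fun j => |a j|) (hW : ∀ j, |w j| ≤ W) :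
    Summable (fun j => a j * w j) ∧ |∑' j, a j * w j| ≤ W * ∑' j, |a j| := by
  have hb : ∀ j, |a j * w j| ≤ W * |a j| := by
    intro j
    rw [abs_mul, mul_comm]
    exact mul_le_mul_of_nonneg_right (hW j) (abs_nonneg _)
  have hs : Summable (fun j => |a j * w j|) :=
    Summable.of_nonneg_of_le (fun _ => abs_nonneg _) hb (ha.mul_left W)
  refine ⟨hs.of_abs, ?_⟩
  rw [← tsum_mul_left]
  refine le_trans ?_ (hs.tsum_le_tsum hb (ha.mul_left W))
  simpa [Real.norm_eq_abs] using norm_tsum_le_tsum_norm (f := fun j => a j * w j) hs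

lemma sum_trunc {a w : ℤ → ℝ} {W δ : ℝ} (ha : Summable fun j => |a j|) (hW : ∀ j, |w j| ≤ W)
    (s : Finset ℤ) (hδ : 0 ≤ δ) (hs : ∀ j, j ∉ s → |w j| ≤ δ) :
    |∑' j, a j * w j - ∑ j ∈ s, a j * w j| ≤ δ * ∑' j, |a j| := by
  have h1 := sum_mul_bdd ha hW
  have h2 : ∑ j ∈ s, a j * w j = ∑' j, a j * (if j ∈ s then w j else 0) := by
    rw [tsum_eq_sum (s := s) (fun j hj => by simp [hj])]
    exact Finset.sum_congr rfl fun j hj => by simp [hj]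
  have h3 : Summable fun j => a j * (if j ∈ s then w j else 0) :=
    summable_of_ne_finset_zero (s := s) (fun j hj => by simp [hj])
  have h4 := sum_mul_bdd (W := δ) (w := fun j => if j ∈ s then 0 else w j) ha (by
    intro j
    by_cases hj : j ∈ s
    · simpa [hj] using hδ
    · simpa [hj] using hs j hj)
  rw [h2, ← h1.1.tsum_sub h3]
  have e : ∑' j, (a j * w j - a j * (if j ∈ s then w j else 0))
      = ∑' j, a j * (if j ∈ s then 0 else w j) :=
    tsum_congr fun j => by split_ifs <;> ring
  rw [e]
  exact h4.2

lemma sbp {β : ℝ → ℝ} {u : ℝ → ℝ} {M h x : ℝ} (hM : ∀ y, |u y| ≤ M)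
    (hs : ∀ x, Summable (fun j : ℤ => |β (x - j * h)|)) :
    ∑' j : ℤ, (β (x - (j - 1) * h) - 2 * β (x - j * h) + β (x - (j + 1) * h)) * u (j * h)
      = ∑' j : ℤ, β (x - j * h) * (u (j * h + h) - 2 * u (j * h) + u (j * h - h)) := by
  have s0 := (sum_mul_bdd (w := fun j : ℤ => u (j * h)) (hs x) (fun j => hM _)).1
  have sp := (sum_mul_bdd (w := fun j : ℤ => u (j * h + h)) (hs x) (fun j => hM _)).1
  have sm := (sum_mul_bdd (w := fun j : ℤ => u (j * h - h)) (hs x) (fun j => hM _)).1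
  have ep : ∀ j : ℤ, β (x - ((Equiv.addRight (-1 : ℤ) j : ℤ) : ℝ) * h) *
      u (((Equiv.addRight (-1 : ℤ) j : ℤ) : ℝ) * h + h) = β (x - (j - 1) * h) * u (j * h) := by
    intro j; simp only [Equiv.coe_addRight]; push_cast; congr 2 <;> ring
  have em : ∀ j : ℤ, β (x - ((Equiv.addRight (1 : ℤ) j : ℤ) : ℝ) * h) *
      u (((Equiv.addRight (1 : ℤ) j : ℤ) : ℝ) * h - h) = β (x - (j + 1) * h) * u (j * h) := by
    intro j; simp only [Equiv.coe_addRight]; push_cast; congr 2; ring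
  have tp := (Equiv.addRight (-1 : ℤ)).tsum_eq (fun j : ℤ => β (x - j * h) * u (j * h + h))
  have tm := (Equiv.addRight (1 : ℤ)).tsum_eq (fun j : ℤ => β (x - j * h) * u (j * h - h))
  have sp' := (Equiv.addRight (-1 : ℤ)).summable_iff.2 sp
  have sm' := (Equiv.addRight (1 : ℤ)).summable_iff.2 sm
  simp only [Function.comp_def, ep, em] at tp tm sp' sm'
  have e1 := ((sp'.hasSum.sub (s0.hasSum.mul_left 2)).add sm'.hasSum)
  have e2 := ((sp.hasSum.sub (s0.hasSum.mul_left 2)).add sm.hasSum)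
  rw [tp, tm] at e1
  have e1' := e1.tsum_eq
  have e2' := e2.tsum_eq
  rw [← e2'] at e1'
  refine (tsum_congr fun j => ?_).trans (e1'.trans (tsum_congr fun j => ?_)) <;> ring

lemma consist {β β1 β2 u u1 u2 u3 u4 : ℝ → ℝ} (hb : ∀ x, HasDerivAt β (β1 x) x)
    (hb1 : ∀ x, HasDerivAt β1 (β2 x) x)
    (hi0 : Integrable β) (hi1 : Integrable β1) (hi2 : Integrable β2)
    (h1 : ∀ x, HasDerivAt u (u1 x) x)
    (h2 : ∀ x, HasDerivAt u1 (u2 x) x) (h3 : ∀ x, HasDerivAt u2 (u3 x) x)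
    (h4 : ∀ x, HasDerivAt u3 (u4 x) x) {M : ℝ} (hM0 : ∀ x, |u x| ≤ M) (hM1 : ∀ x, |u1 x| ≤ M)
    (hM2 : ∀ x, |u2 x| ≤ M) (hM3 : ∀ x, |u3 x| ≤ M) (hM4 : ∀ x, |u4 x| ≤ M)
    {h : ℝ} (hh : 0 < h) (hh1 : h ≤ 1) (x : ℝ) :
    |(∫ y, β2 (x - y) * u y) - ∑' j : ℤ, h *
      ((β (x - (j - 1) * h) - 2 * β (x - j * h) + β (x - (j + 1) * h)) / h ^ 2) * u (j * h)| ≤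
      h ^ 2 * (M * ((∫ s, |β2 s|) + 4 * (∫ s, |β1 s|) + 3 * ∫ s, |β s|)) := by
  have hM : 0 ≤ M := (abs_nonneg _).trans (hM0 0)
  obtain ⟨hs, hA⟩ := convA hb hi0 hi1 hh x
  have eI : (∫ y, β2 (x - y) * u y) = ∫ y, β (x - y) * u2 y := by
    rw [ibp1 hb1 hi1 hi2 h1 hM0 hM1, ibp1 hb hi0 hi1 h2 hM1 hM2]
  have eS : ∑' j : ℤ, h *
      ((β (x - (j - 1) * h) - 2 * β (x - j * h) + β (x - (j + 1) * h)) / h ^ 2) * u (j * h)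
      = h * ∑' j : ℤ, β (x - j * h) * ((u (j * h + h) - 2 * u (j * h) + u (j * h - h)) / h ^ 2) := by
    have := sbp (x := x) hM0 (fun x => (convA hb hi0 hi1 hh x).1)
    calc _ = ∑' j : ℤ, (h / h ^ 2) * ((β (x - (j - 1) * h) - 2 * β (x - j * h)
              + β (x - (j + 1) * h)) * u (j * h)) := by
            congr 1; ext j; ring
      _ = (h / h ^ 2) * ∑' j : ℤ, β (x - j * h) * (u (j * h + h) - 2 * u (j * h)
            + u (j * h - h)) := by rw [tsum_mul_left, this]
      _ = _ := by
            rw [← tsum_mul_left, ← tsum_mul_left]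
            congr 1; ext j; ring
  have q := convQ hb hb1 hi0 hi1 hi2 h3 h4 hM2 hM3 hM4 hh x
  have hd : ∀ j : ℤ, |u2 (j * h) - (u (j * h + h) - 2 * u (j * h) + u (j * h - h)) / h ^ 2|
      ≤ 2 * M * h ^ 2 := by
    intro j
    rw [abs_sub_comm]
    exact d2err h1 h2 h3 h4 hM4 hh _
  have sd := sum_mul_bdd hs hd
  have s2 := sum_mul_bdd (w := fun j : ℤ => u2 (j * h)) hs (fun j => hM2 _)
  have e3 : ∑' j : ℤ, β (x - j * h) * ((u (j * h + h) - 2 * u (j * h) + u (j * h - h)) / h ^ 2)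
     = ∑' j : ℤ, β (x - j * h) * u2 (j * h) - ∑' j : ℤ, β (x - j * h) *
      (u2 (j * h) - (u (j * h + h) - 2 * u (j * h) + u (j * h - h)) / h ^ 2) := by
    rw [← s2.1.tsum_sub sd.1]
    congr 1; ext j; ring
  rw [eI, eS, e3]
  set D := ∑' j : ℤ, β (x - j * h) *
      (u2 (j * h) - (u (j * h + h) - 2 * u (j * h) + u (j * h - h)) / h ^ 2)
  have hD : |h * D| ≤ h ^ 2 * (M * (2 * (∫ s, |β1 s|) + 2 * ∫ s, |β s|)) := by
    rw [abs_mul, abs_of_pos hh]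
    calc h * |D| ≤ h * (2 * M * h ^ 2 * ∑' j : ℤ, |β (x - j * h)|) :=
          mul_le_mul_of_nonneg_left sd.2 hh.le
      _ = (2 * M * h ^ 2) * (h * ∑' j : ℤ, |β (x - j * h)|) := by ring
      _ ≤ (2 * M * h ^ 2) * ((∫ s, |β s|) + 1 * ∫ s, |β1 s|) := by
          refine mul_le_mul_of_nonneg_left (hA.trans ?_) (by positivity)
          gcongr
      _ = _ := by ring
  have e5 : ∀ I S : ℝ, I - h * (S - D) = (I - h * S) + h * D := by intros; ring
  rw [e5]
  refine (abs_add_le _ _).trans ?_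
  refine (add_le_add q hD).trans (le_of_eq ?_)
  ring

lemma clamp_lip (R x y : ℝ) : |max (-R) (min R x) - max (-R) (min R y)| ≤ |x - y| := by
  rw [max_comm, max_comm (-R), min_comm, min_comm R y]
  refine (abs_max_sub_max_le_abs (min x R) (min y R) (-R)).trans ?_
  refine (abs_min_sub_min_le_max x R y R).trans ?_
  simp

lemma clamp_mem {R : ℝ} (hR : 0 ≤ R) (x : ℝ) : max (-R) (min R x) ∈ Set.Icc (-R) R :=
  ⟨le_max_left _ _, max_le (by linarith) (min_le_left _ _)⟩

lemma clamp_eq {R x : ℝ} (hx : |x| ≤ R) : max (-R) (min R x) = x := by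
  rw [abs_le] at hx
  rw [min_eq_right hx.2, max_eq_right hx.1]

lemma sum_abs_le {ι : Type*} [Fintype ι] {a w : ι → ℝ} {A W : ℝ} (hA : ∑ j, |a j| ≤ A)
    (hW0 : 0 ≤ W) (hW : ∀ j, |w j| ≤ W) : |∑ j, a j * w j| ≤ A * W := by
  refine (Finset.abs_sum_le_sum_abs _ _).trans ?_
  refine le_trans ?_ (mul_le_mul_of_nonneg_right hA hW0)
  rw [Finset.sum_mul]
  apply Finset.sum_le_sum
  intro j _
  rw [abs_mul]
  exact mul_le_mul_of_nonneg_left (hW j) (abs_nonneg _)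

lemma ode_lemma {ι : Type*} [Fintype ι] (a b : ι → ι → ℝ) (f : ℝ → ℝ) {A B L R T ρ : ℝ}
    (hA0 : 0 ≤ A) (hB0 : 0 ≤ B) (hL0 : 0 ≤ L) (hR : 1 ≤ R) (hT : 0 < T) (hρ : 0 ≤ ρ)
    (hA : ∀ i, ∑ j, |a i j| ≤ A) (hB : ∀ i, ∑ j, |b i j| ≤ B) (hf0 : f 0 = 0)
    (hfL : ∀ x ∈ Set.Icc (-R) R, ∀ y ∈ Set.Icc (-R) R, |f x - f y| ≤ L * |x - y|)
    (y y' : ℝ → ι → ℝ) (hy : ∀ t ∈ Set.Icc 0 T, HasDerivAt y (y' t) t)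
    (hyM : ∀ t ∈ Set.Icc 0 T, ∀ i, |y t i| ≤ R - 1)
    (res : ∀ t ∈ Set.Icc 0 T, ∀ i,
      |y' t i - (-(∑ j, a i j * f (y t j)) - ∑ j, b i j * y t j)| ≤ ρ)
    (hsmall : ρ * Real.exp ((A * L + B + 1) * T) ≤ 1) :
    ∃ v : ℝ → ι → ℝ, v 0 = y 0 ∧
      (∀ t ∈ Set.Icc 0 T, ∀ i, HasDerivAt (fun s => v s i)
        (-(∑ j, a i j * f (v t j)) - ∑ j, b i j * v t j) t) ∧
      (∀ t ∈ Set.Icc 0 T, ∀ i, |y t i - v t i| ≤ ρ * Real.exp ((A * L + B + 1) * T)) := by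
  set cl : ℝ → ℝ := fun x => max (-R) (min R x) with hcl
  have hR0 : 0 ≤ R := by linarith
  set F : (ι → ℝ) → ι → ℝ := fun v i => -(∑ j, a i j * f (cl (v j))) - ∑ j, b i j * cl (v j) with hF
  have hK0 : 0 ≤ A * L + B + 1 := by positivity
  set K : NNReal := ⟨A * L + B + 1, hK0⟩ with hK
  have hKc : (K : ℝ) = A * L + B + 1 := rfl
  have hFL : LipschitzWith K F := by
    apply LipschitzWith.of_dist_le_mul
    intro v w
    rw [dist_pi_le_iff (by positivity)]
    intro i
    rw [Real.dist_eq, hKc]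
    have e : F v i - F w i = -(∑ j, a i j * (f (cl (v j)) - f (cl (w j))))
        - ∑ j, b i j * (cl (v j) - cl (w j)) := by
      simp only [hF, mul_sub, Finset.sum_sub_distrib]; ring
    have hc : ∀ j, |cl (v j) - cl (w j)| ≤ dist v w := fun j =>
      (clamp_lip R _ _).trans (by rw [← Real.dist_eq]; exact dist_le_pi_dist v w j)
    have h1 := sum_abs_le (w := fun j => f (cl (v j)) - f (cl (w j))) (hA i)
      (W := L * dist v w) (by positivity)
      (fun j => (hfL _ (clamp_mem hR0 _) _ (clamp_mem hR0 _)).trans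
        (mul_le_mul_of_nonneg_left (hc j) hL0))
    have h2 := sum_abs_le (w := fun j => cl (v j) - cl (w j)) (hB i) (W := dist v w)
      dist_nonneg hc
    rw [e]
    refine (abs_sub _ _).trans ?_
    rw [abs_neg]
    have := dist_nonneg (x := v) (y := w)
    nlinarith
  have hFb : ∀ v, ‖F v‖ ≤ A * (L * R) + B * R := by
    intro v
    rw [pi_norm_le_iff_of_nonneg (by positivity)]
    intro i
    have hc : ∀ j, |cl (v j)| ≤ R := fun j => abs_le.2 (clamp_mem hR0 (v j))
    have h1 := sum_abs_le (w := fun j => f (cl (v j))) (hA i)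
      (W := L * R) (by positivity)
      (fun j => by
        have := hfL _ (clamp_mem hR0 (v j)) 0 ⟨by linarith, hR0⟩
        rw [hf0, sub_zero, sub_zero] at this
        exact this.trans (mul_le_mul_of_nonneg_left (hc j) hL0))
    have h2 := sum_abs_le (w := fun j => cl (v j)) (hB i) (W := R) hR0 hc
    rw [Real.norm_eq_abs]
    refine (abs_sub _ _).trans ?_
    rw [abs_neg]
    exact add_le_add h1 h2
  set Lb : NNReal := ⟨A * (L * R) + B * R, by positivity⟩ with hLb
  obtain ⟨T1, hT1⟩ : ∃ T1 : NNReal, (T1 : ℝ) = T + 1 := ⟨⟨T + 1, by linarith⟩, rfl⟩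
  have hPL : IsPicardLindelof (fun _ : ℝ => F) (tmin := -1) (tmax := T + 1)
      ⟨0, by constructor <;> linarith⟩ (y 0) (Lb * T1) 0 Lb K := by
    constructor
    · intro t _; exact hFL.lipschitzOnWith
    · intro x _; exact continuousOn_const
    · intro t _ x _; exact hFb x
    · have : max (T + 1 - 0) (0 - -1) = T + 1 := by
        rw [max_eq_left] <;> linarith
      simp only [this]
      rw [NNReal.coe_mul, hT1, NNReal.coe_zero, sub_zero]
  obtain ⟨v, hv0, hv⟩ := hPL.exists_eq_forall_mem_Icc_hasDerivWithinAt₀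
  simp only at hv0
  have hvd : ∀ t ∈ Set.Icc 0 T, HasDerivAt v (F (v t)) t := fun t ht =>
    (hv t ⟨by linarith [ht.1], by linarith [ht.2]⟩).hasDerivAt
      (Icc_mem_nhds (by linarith [ht.1]) (by linarith [ht.2]))
  have hFy : ∀ t ∈ Set.Icc 0 T, ∀ i, F (y t) i =
      -(∑ j, a i j * f (y t j)) - ∑ j, b i j * y t j := by
    intro t ht i
    have : ∀ j, cl (y t j) = y t j := fun j => clamp_eq (by linarith [hyM t ht j])
    simp only [hF, this]
  have G := dist_le_of_approx_trajectories_ODE (v := fun _ => F) (K := K) (f := y) (g := v)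
    (f' := y') (g' := fun t => F (v t)) (a := 0) (b := T) (εf := ρ) (εg := 0) (δ := 0)
    (fun _ => hFL) (fun t ht => (hy t ht).continuousAt.continuousWithinAt)
    (fun t ht => (hy t ⟨ht.1, ht.2.le⟩).hasDerivWithinAt)
    (fun t ht => by
      rw [dist_pi_le_iff hρ]
      intro i
      rw [Real.dist_eq, hFy t ⟨ht.1, ht.2.le⟩]
      exact res t ⟨ht.1, ht.2.le⟩ i)
    (fun t ht => (hvd t ht).continuousAt.continuousWithinAt)
    (fun t ht => (hvd t ⟨ht.1, ht.2.le⟩).hasDerivWithinAt)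
    (fun t ht => by simp) (by simp [hv0])
  have err : ∀ t ∈ Set.Icc 0 T, ∀ i,
      |y t i - v t i| ≤ ρ * Real.exp ((A * L + B + 1) * T) := by
    intro t ht i
    have h1 := (dist_le_pi_dist (y t) (v t) i).trans (G t ht)
    rw [Real.dist_eq] at h1
    refine h1.trans ?_
    have hK1 : 1 ≤ A * L + B + 1 := by have : 0 ≤ A * L + B := by positivity
                                       linarith
    rw [hKc, gronwallBound_of_K_ne_0 (by linarith)]
    simp only [zero_mul, zero_add, add_zero, sub_zero]
    have e1 : Real.exp ((A * L + B + 1) * t) ≤ Real.exp ((A * L + B + 1) * T) :=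
      Real.exp_le_exp.2 (mul_le_mul_of_nonneg_left ht.2 hK0)
    have e2 : 1 ≤ Real.exp ((A * L + B + 1) * t) := Real.one_le_exp (mul_nonneg hK0 ht.1)
    apply mul_le_mul (div_le_self hρ hK1) (by linarith) (by linarith) hρ
  refine ⟨v, hv0, fun t ht i => ?_, err⟩
  have : ∀ j, cl (v t j) = v t j := fun j => clamp_eq (by
    have h1 := err t ht j
    have h2 := hyM t ht j
    have h3 := abs_sub_abs_le_abs_sub (v t j) (y t j)
    rw [abs_sub_comm] at h3
    linarith)
  have h1 := hasDerivAt_pi.1 (hvd t ht) i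
  simpa only [hF, this] using h1

lemma kerA {β β1 : ℝ → ℝ} (hb : ∀ x, HasDerivAt β (β1 x) x)
    (hi0 : Integrable β) (hi1 : Integrable β1) {h : ℝ} (hh : 0 < h) (hh1 : h ≤ 1) (x : ℝ) :
    Summable (fun j : ℤ => |h * β (x - j * h)|) ∧
      ∑' j : ℤ, |h * β (x - j * h)| ≤ (∫ s, |β s|) + ∫ s, |β1 s| := by
  obtain ⟨h1, h2⟩ := convA hb hi0 hi1 hh x
  simp only [abs_mul, abs_of_pos hh]
  refine ⟨h1.mul_left h, ?_⟩
  rw [tsum_mul_left]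
  refine h2.trans ?_
  have : 0 ≤ ∫ s, |β1 s| := integral_nonneg fun _ => abs_nonneg _
  nlinarith

lemma kerD {β β1 β2 : ℝ → ℝ} (hb : ∀ x, HasDerivAt β (β1 x) x)
    (hb1 : ∀ x, HasDerivAt β1 (β2 x) x)
    (hi2 : Integrable β2) {h : ℝ} (hh : 0 < h) (x : ℝ) :
    Summable (fun j : ℤ => |h * ((β (x - (j - 1) * h) - 2 * β (x - j * h)
      + β (x - (j + 1) * h)) / h ^ 2)|) ∧
      ∑' j : ℤ, |h * ((β (x - (j - 1) * h) - 2 * β (x - j * h)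
      + β (x - (j + 1) * h)) / h ^ 2)| ≤ 2 * ∫ s, |β2 s| := by
  obtain ⟨h1, h2⟩ := convD hb hb1 hi2 hh x
  have e : ∀ j : ℤ, |h * ((β (x - (j - 1) * h) - 2 * β (x - j * h)
      + β (x - (j + 1) * h)) / h ^ 2)| = h⁻¹ * |β (x - (j - 1) * h) - 2 * β (x - j * h)
      + β (x - (j + 1) * h)| := by
    intro j
    rw [abs_mul, abs_div, abs_of_pos hh, abs_of_pos (pow_pos hh 2)]
    field_simp
  simp only [e]
  refine ⟨h1.mul_left _, ?_⟩
  rw [tsum_mul_left, inv_mul_le_iff₀ hh]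
  linarith

lemma residual_bd {β β1 β2 u u1 u2 u3 u4 f f1 f2 : ℝ → ℝ} (hb : ∀ x, HasDerivAt β (β1 x) x)
    (hb1 : ∀ x, HasDerivAt β1 (β2 x) x)
    (hi0 : Integrable β) (hi1 : Integrable β1) (hi2 : Integrable β2)
    (h1 : ∀ x, HasDerivAt u (u1 x) x)
    (h2 : ∀ x, HasDerivAt u1 (u2 x) x) (h3 : ∀ x, HasDerivAt u2 (u3 x) x)
    (h4 : ∀ x, HasDerivAt u3 (u4 x) x) {M : ℝ} (hM0 : ∀ x, |u x| ≤ M) (hM1 : ∀ x, |u1 x| ≤ M)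
    (hM2 : ∀ x, |u2 x| ≤ M) (hM3 : ∀ x, |u3 x| ≤ M) (hM4 : ∀ x, |u4 x| ≤ M)
    (hf1 : ∀ x, HasDerivAt f (f1 x) x) (hf2 : ∀ x, HasDerivAt f1 (f2 x) x) {D : ℝ}
    (hD0 : ∀ x, |x| ≤ M → |f x| ≤ D) (hD1 : ∀ x, |x| ≤ M → |f1 x| ≤ D)
    (hD2 : ∀ x, |x| ≤ M → |f2 x| ≤ D) (hfL : ∀ x, |x| ≤ M → |f x| ≤ D * |x|)
    {κ : ℝ} (hκ : 0 < κ) {h : ℝ} (hh : 0 < h) (hh1 : h ≤ 1) (x : ℝ) (s : Finset ℤ) {δ : ℝ}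
    (hδ : 0 ≤ δ) (hs : ∀ j : ℤ, j ∉ s → |u (j * h)| ≤ δ) :
    |(-(∫ y, β (x - y) * f (u y)) - κ * ∫ y, β2 (x - y) * u y) -
      (-(∑ j ∈ s, h * β (x - j * h) * f (u (j * h))) -
        κ * ∑ j ∈ s, h * ((β (x - (j - 1) * h) - 2 * β (x - j * h)
          + β (x - (j + 1) * h)) / h ^ 2) * u (j * h))| ≤
      h ^ 2 * (D * (1 + M + M ^ 2) * ((∫ s, |β2 s|) + 2 * (∫ s, |β1 s|) + ∫ s, |β s|) +
        κ * (M * ((∫ s, |β2 s|) + 4 * (∫ s, |β1 s|) + 3 * ∫ s, |β s|))) +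
      δ * (D * ((∫ s, |β s|) + ∫ s, |β1 s|) + κ * (2 * ∫ s, |β2 s|)) := by
  have hM : 0 ≤ M := (abs_nonneg _).trans (hM0 0)
  have hD : 0 ≤ D := (abs_nonneg _).trans (hD0 _ (hM0 0))
  have q1 := convQ (w := fun y => f (u y)) (w1 := fun y => f1 (u y) * u1 y)
    (w2 := fun y => f2 (u y) * u1 y * u1 y + f1 (u y) * u2 y) (W := D * (1 + M + M ^ 2))
    hb hb1 hi0 hi1 hi2 (fun y => (hf1 (u y)).comp y (h1 y))
    (fun y => ((hf2 (u y)).comp y (h1 y)).mul (h2 y))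
    (fun y => by have := hD0 _ (hM0 y); nlinarith [mul_nonneg hD hM, mul_nonneg hD (sq_nonneg M)])
    (fun y => by
      rw [abs_mul]
      have := mul_le_mul (hD1 _ (hM0 y)) (hM1 y) (abs_nonneg _) hD
      nlinarith [mul_nonneg hD hM, mul_nonneg hD (sq_nonneg M)])
    (fun y => by
      refine (abs_add_le _ _).trans ?_
      rw [abs_mul, abs_mul, abs_mul]
      have e1 := mul_le_mul (hD1 _ (hM0 y)) (hM2 y) (abs_nonneg _) hD
      have e2 := mul_le_mul (hD2 _ (hM0 y)) (hM1 y) (abs_nonneg _) hD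
      have e3 := mul_le_mul e2 (hM1 y) (abs_nonneg _) (by positivity)
      nlinarith [mul_nonneg hD hM, mul_nonneg hD (sq_nonneg M)]) hh x
  have q2 := consist hb hb1 hi0 hi1 hi2 h1 h2 h3 h4 hM0 hM1 hM2 hM3 hM4 hh hh1 x
  obtain ⟨sA, bA⟩ := kerA hb hi0 hi1 hh hh1 x
  obtain ⟨sD, bD⟩ := kerD hb hb1 hi2 hh x
  have t1 := sum_trunc (w := fun j : ℤ => f (u (j * h))) (δ := δ * D) sA
    (fun j => hD0 _ (hM0 _)) s (by positivity)
    (fun j hj => (hfL _ (hM0 _)).trans (by nlinarith [hs j hj]))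
  have t2 := sum_trunc (w := fun j : ℤ => u (j * h)) sD (fun j => hM0 _) s hδ hs
  have t1' := t1.trans (mul_le_mul_of_nonneg_left bA (by positivity))
  have t2' := t2.trans (mul_le_mul_of_nonneg_left bD hδ)
  have e1 : h * ∑' j : ℤ, β (x - j * h) * f (u (j * h))
      = ∑' j : ℤ, h * β (x - j * h) * f (u (j * h)) := by
    rw [← tsum_mul_left]; exact tsum_congr fun j => by ring
  rw [e1] at q1
  have r1 := (abs_add_le _ _).trans (add_le_add q1 t1')
  have r2 := mul_le_mul_of_nonneg_left ((abs_add_le _ _).trans (add_le_add q2 t2')) hκ.le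
  rw [sub_add_sub_cancel] at r1 r2
  have key : ∀ I J S S' : ℝ, |(-I - κ * J) - (-S - κ * S')| ≤ |I - S| + κ * |J - S'| := by
    intro I J S S'
    calc _ = |(I - S) + κ * (J - S')| := by rw [← abs_neg]; congr 1; ring
      _ ≤ |I - S| + |κ * (J - S')| := abs_add_le _ _
      _ = _ := by rw [abs_mul, abs_of_pos hκ]
  refine (key _ _ _ _).trans ((add_le_add r1 r2).trans (le_of_eq ?_))
  ring

lemma bdd_on_compact {g : ℝ → ℝ} (hg : Continuous g) (R : ℝ) :
    ∃ D, ∀ x ∈ Set.Icc (-R) R, |g x| ≤ D := by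
  obtain ⟨D, hD⟩ := (isCompact_Icc (a := -R) (b := R)).exists_bound_of_continuousOn hg.continuousOn
  exact ⟨D, hD⟩

/-- **Combined discretization and localization error** (Theorem 4.2, regular kernel case).
If `u` solves the continuous nonlocal equation on `[0,T]`, decays to `0` as `|x| → ∞`
uniformly in `t`, and satisfies the smoothness/boundedness/integrability hypotheses, then
there are `C > 0` and `h₀ > 0` so that for every `h ∈ (0, h₀]` and `ε > 0` there is `N`
for which the truncated semi-discrete system with initial data `u(0, ih)` has a solution
on `[0,T]` with `max_{|i|≤N} |u(t, ih) − v_i(t)| ≤ C(h² + ε)`. -/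
theorem truncated_combined_error
    (α : ℝ → ℝ) (κ T : ℝ) (f : ℝ → ℝ) (u : ℝ → ℝ → ℝ) (Mtilde K : ℝ)
    (hα : ContDiff ℝ 3 α)
    (hα0 : Integrable α) (hα1 : Integrable (deriv α))
    (hα2 : Integrable (iteratedDeriv 2 α)) (hα3 : Integrable (iteratedDeriv 3 α))
    (hκ : 0 < κ) (hT : 0 < T)
    (hf : ContDiff ℝ 2 f) (hf0 : f 0 = 0)
    (hudiff : ∀ t ∈ Set.Icc (0 : ℝ) T, ∀ k < 4, Differentiable ℝ (iteratedDeriv k (u t)))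
    (hub : ∀ t ∈ Set.Icc (0 : ℝ) T, ∀ k ≤ 4, ∀ x : ℝ, |iteratedDeriv k (u t) x| ≤ Mtilde)
    (huint : ∀ t ∈ Set.Icc (0 : ℝ) T, ∀ k ≤ 2,
      Integrable (iteratedDeriv k (u t)) ∧ (∫ x : ℝ, |iteratedDeriv k (u t) x|) ≤ K)
    (hueq : ∀ t ∈ Set.Icc (0 : ℝ) T, ∀ x : ℝ,
      HasDerivAt (fun s => u s x)
        (-(∫ y : ℝ, deriv α (x - y) * f (u t y)) -
          κ * ∫ y : ℝ, iteratedDeriv 3 α (x - y) * u t y) t)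
    -- u(t, x) → 0 as |x| → ∞, uniformly in t ∈ [0, T]
    (hudecay : ∀ ε' : ℝ, 0 < ε' → ∃ R : ℝ,
      ∀ t ∈ Set.Icc (0 : ℝ) T, ∀ x : ℝ, R ≤ |x| → |u t x| ≤ ε') :
    ∃ C : ℝ, 0 < C ∧ ∃ h₀ : ℝ, 0 < h₀ ∧
      ∀ h ∈ Set.Ioc (0 : ℝ) h₀, ∀ ε : ℝ, 0 < ε →
        ∃ N : ℕ, ∃ v : ℝ → ℤ → ℝ,
          (∀ i : ℤ, |i| ≤ (N : ℤ) → v 0 i = u 0 (i * h)) ∧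
          (∀ i : ℤ, |i| ≤ (N : ℤ) → ∀ t ∈ Set.Icc (0 : ℝ) T,
            HasDerivAt (fun s => v s i)
              (-(∑ j ∈ Finset.Icc (-(N : ℤ)) (N : ℤ),
                  h * deriv α (((i - j : ℤ) : ℝ) * h) * f (v t j)) -
                κ * ∑ j ∈ Finset.Icc (-(N : ℤ)) (N : ℤ),
                  h * ((deriv α (((i - j + 1 : ℤ) : ℝ) * h) -
                    2 * deriv α (((i - j : ℤ) : ℝ) * h) +
                    deriv α (((i - j - 1 : ℤ) : ℝ) * h)) / h ^ 2) * v t j) t) ∧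
          (∀ t ∈ Set.Icc (0 : ℝ) T, ∀ i : ℤ, |i| ≤ (N : ℤ) →
            |u t (i * h) - v t i| ≤ C * (h ^ 2 + ε)) := by
  have hb : ∀ x, HasDerivAt (deriv α) (iteratedDeriv 2 α x) x := by
    intro x
    have h := ((hα.differentiable_iteratedDeriv 1 (by norm_num)) x).hasDerivAt
    rw [← iteratedDeriv_succ, iteratedDeriv_one] at h
    exact h
  have hb1 : ∀ x, HasDerivAt (iteratedDeriv 2 α) (iteratedDeriv 3 α x) x := by
    intro x
    have h := ((hα.differentiable_iteratedDeriv 2 (by norm_num)) x).hasDerivAt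
    rw [← iteratedDeriv_succ] at h
    exact h
  have hf1 : ∀ x, HasDerivAt f (deriv f x) x := fun x =>
    (hf.differentiable (by norm_num) x).hasDerivAt
  have hf2 : ∀ x, HasDerivAt (deriv f) (iteratedDeriv 2 f x) x := by
    intro x
    have h := ((hf.differentiable_iteratedDeriv 1 (by norm_num)) x).hasDerivAt
    rw [← iteratedDeriv_succ, iteratedDeriv_one] at h
    exact h
  have hu : ∀ t ∈ Set.Icc (0 : ℝ) T, ∀ k < 4, ∀ x,
      HasDerivAt (iteratedDeriv k (u t)) (iteratedDeriv (k + 1) (u t) x) x := by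
    intro t ht k hk x
    rw [iteratedDeriv_succ]
    exact (hudiff t ht k hk x).hasDerivAt
  have hu0 : ∀ t ∈ Set.Icc (0 : ℝ) T, ∀ x, |u t x| ≤ Mtilde := by
    intro t ht x
    simpa using hub t ht 0 (by norm_num) x
  have hM : 0 ≤ Mtilde := (abs_nonneg _).trans (hu0 0 ⟨le_rfl, hT.le⟩ 0)
  obtain ⟨D0, hD0⟩ := bdd_on_compact hf.continuous (Mtilde + 1)
  obtain ⟨D1, hD1⟩ := bdd_on_compact (hf.continuous_deriv (by norm_num)) (Mtilde + 1)
  obtain ⟨D2, hD2⟩ := bdd_on_compact (hf.continuous_iteratedDeriv 2 (by norm_num)) (Mtilde + 1)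
  obtain ⟨D, hDd⟩ : ∃ D, D = max D0 (max D1 D2) := ⟨_, rfl⟩
  replace hD0 : ∀ x ∈ Set.Icc (-(Mtilde + 1)) (Mtilde + 1), |f x| ≤ D := fun x hx =>
    (hD0 x hx).trans (by rw [hDd]; exact le_max_left _ _)
  replace hD1 : ∀ x ∈ Set.Icc (-(Mtilde + 1)) (Mtilde + 1), |deriv f x| ≤ D := fun x hx =>
    (hD1 x hx).trans (by rw [hDd]; exact (le_max_left _ _).trans (le_max_right _ _))
  replace hD2 : ∀ x ∈ Set.Icc (-(Mtilde + 1)) (Mtilde + 1), |iteratedDeriv 2 f x| ≤ D := fun x hx =>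
    (hD2 x hx).trans (by rw [hDd]; exact (le_max_right _ _).trans (le_max_right _ _))
  have h0mem : (0 : ℝ) ∈ Set.Icc (-(Mtilde + 1)) (Mtilde + 1) := ⟨by linarith, by linarith⟩
  have hD : 0 ≤ D := (abs_nonneg _).trans (hD0 0 h0mem)
  have hmem : ∀ x, |x| ≤ Mtilde → x ∈ Set.Icc (-(Mtilde + 1)) (Mtilde + 1) := by
    intro x hx
    rw [abs_le] at hx
    exact ⟨by linarith, by linarith⟩
  have hfL : ∀ x ∈ Set.Icc (-(Mtilde + 1)) (Mtilde + 1),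
      ∀ y ∈ Set.Icc (-(Mtilde + 1)) (Mtilde + 1), |f x - f y| ≤ D * |x - y| := by
    intro x hx y hy
    exact Convex.norm_image_sub_le_of_norm_hasDerivWithin_le
      (fun z _ => (hf1 z).hasDerivWithinAt) hD1 (convex_Icc _ _) hy hx
  obtain ⟨I0, hI0⟩ : ∃ I, I = ∫ s, |deriv α s| := ⟨_, rfl⟩
  obtain ⟨I1, hI1⟩ : ∃ I, I = ∫ s, |iteratedDeriv 2 α s| := ⟨_, rfl⟩
  obtain ⟨I2, hI2⟩ : ∃ I, I = ∫ s, |iteratedDeriv 3 α s| := ⟨_, rfl⟩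
  have I0n : 0 ≤ I0 := by rw [hI0]; exact integral_nonneg fun _ => abs_nonneg _
  have I1n : 0 ≤ I1 := by rw [hI1]; exact integral_nonneg fun _ => abs_nonneg _
  have I2n : 0 ≤ I2 := by rw [hI2]; exact integral_nonneg fun _ => abs_nonneg _
  obtain ⟨c1, hc1⟩ : ∃ c, c = D * (1 + Mtilde + Mtilde ^ 2) * (I2 + 2 * I1 + I0) +
        κ * (Mtilde * (I2 + 4 * I1 + 3 * I0)) := ⟨_, rfl⟩
  obtain ⟨c2, hc2⟩ : ∃ c, c = D * (I0 + I1) + κ * (2 * I2) := ⟨_, rfl⟩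
  have c1n : 0 ≤ c1 := by rw [hc1]; positivity
  have c2n : 0 ≤ c2 := by rw [hc2]; positivity
  obtain ⟨Q, hQ⟩ : ∃ Q, Q = c1 + c2 + 1 := ⟨_, rfl⟩
  have Qp : 0 < Q := by rw [hQ]; positivity
  obtain ⟨E, hE⟩ : ∃ E, E = Real.exp (((I0 + I1) * D + κ * (2 * I2) + 1) * T) := ⟨_, rfl⟩
  have Ep : 0 < E := by rw [hE]; exact Real.exp_pos _
  have QEp : 0 < Q * E := mul_pos Qp Ep
  refine ⟨Q * E, QEp, min 1 (1 / (2 * (Q * E))), by positivity, ?_⟩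
  intro h hh ε hε
  have hh0 : 0 < h := hh.1
  have hh1 : h ≤ 1 := hh.2.trans (min_le_left _ _)
  have hh2 : h ≤ 1 / (2 * (Q * E)) := hh.2.trans (min_le_right _ _)
  obtain ⟨δ, hδ⟩ : ∃ δ, δ = min ε (1 / (2 * (Q * E))) := ⟨_, rfl⟩
  have δp : 0 < δ := by rw [hδ]; positivity
  have δε : δ ≤ ε := by rw [hδ]; exact min_le_left _ _
  have δQ : δ ≤ 1 / (2 * (Q * E)) := by rw [hδ]; exact min_le_right _ _
  have hsmall : Q * (h ^ 2 + δ) * E ≤ 1 := by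
    have e1 : h ^ 2 ≤ 1 / (2 * (Q * E)) := le_trans (by nlinarith) hh2
    calc Q * (h ^ 2 + δ) * E = (Q * E) * (h ^ 2 + δ) := by ring
      _ ≤ (Q * E) * (1 / (2 * (Q * E)) + 1 / (2 * (Q * E))) := by gcongr
      _ = 1 := by field_simp; norm_num
  obtain ⟨Rr, hRr⟩ := hudecay δ δp
  obtain ⟨N, hN⟩ := exists_nat_ge (Rr / h)
  have hNR : Rr ≤ N * h := by rwa [div_le_iff₀ hh0] at hN
  have hmemI : ∀ j : ℤ, j ∈ Finset.Icc (-(N : ℤ)) (N : ℤ) ↔ |j| ≤ (N : ℤ) := by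
    intro j; rw [Finset.mem_Icc, abs_le]
  have hout : ∀ t ∈ Set.Icc (0 : ℝ) T, ∀ j : ℤ, j ∉ Finset.Icc (-(N : ℤ)) (N : ℤ) →
      |u t (j * h)| ≤ δ := by
    intro t ht j hj
    rw [hmemI, not_le] at hj
    apply hRr t ht
    rw [abs_mul, abs_of_pos hh0]
    have : (N : ℝ) ≤ |(j : ℝ)| := by exact_mod_cast hj.le
    nlinarith
  have k1 : ∀ i j : ℤ, ((i - j : ℤ) : ℝ) * h = i * h - j * h := by
    intro i j; push_cast; ring
  have k2 : ∀ i j : ℤ, ((i - j + 1 : ℤ) : ℝ) * h = i * h - (j - 1) * h := by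
    intro i j; push_cast; ring
  have k3 : ∀ i j : ℤ, ((i - j - 1 : ℤ) : ℝ) * h = i * h - (j + 1) * h := by
    intro i j; push_cast; ring
  simp only [k2, k3]
  simp only [k1]
  obtain ⟨S, hS⟩ : ∃ S, S = Finset.Icc (-(N : ℤ)) (N : ℤ) := ⟨_, rfl⟩
  rw [← hS] at hmemI hout
  obtain ⟨v, hv0, hvd, hve⟩ := ode_lemma (ι := S)
    (fun i j => h * deriv α ((i : ℤ) * h - (j : ℤ) * h))
    (fun i j => κ * (h * ((deriv α ((i : ℤ) * h - ((j : ℤ) - 1) * h) -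
      2 * deriv α ((i : ℤ) * h - (j : ℤ) * h) +
      deriv α ((i : ℤ) * h - ((j : ℤ) + 1) * h)) / h ^ 2))) f
    (A := I0 + I1) (B := κ * (2 * I2)) (L := D) (R := Mtilde + 1) (T := T)
    (ρ := Q * (h ^ 2 + δ)) (by positivity) (by positivity) hD (by linarith) hT (by positivity)
    (by
      intro i
      obtain ⟨s1, s2⟩ := kerA hb hα1 hα2 hh0 hh1 ((i : ℤ) * h)
      rw [Finset.sum_coe_sort S (fun j : ℤ => |h * deriv α ((i : ℤ) * h - j * h)|), hI0, hI1]
      exact (s1.sum_le_tsum S (fun _ _ => abs_nonneg _)).trans s2)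
    (by
      intro i
      obtain ⟨s1, s2⟩ := kerD hb hb1 hα3 hh0 ((i : ℤ) * h)
      simp only [abs_mul κ, abs_of_pos hκ]
      rw [← Finset.mul_sum]
      refine mul_le_mul_of_nonneg_left ?_ hκ.le
      rw [Finset.sum_coe_sort S (fun j : ℤ => |h * ((deriv α ((i : ℤ) * h - (j - 1) * h) -
        2 * deriv α ((i : ℤ) * h - j * h) +
        deriv α ((i : ℤ) * h - (j + 1) * h)) / h ^ 2)|), hI2]
      exact (s1.sum_le_tsum S (fun _ _ => abs_nonneg _)).trans s2)
    hf0 hfL (fun t i => u t ((i : ℤ) * h))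
    (fun t i => -(∫ y : ℝ, deriv α ((i : ℤ) * h - y) * f (u t y)) -
          κ * ∫ y : ℝ, iteratedDeriv 3 α ((i : ℤ) * h - y) * u t y)
    (fun t ht => hasDerivAt_pi.2 fun i => hueq t ht _)
    (fun t ht i => by rw [add_sub_cancel_right]; exact hu0 t ht _)
    (by
      intro t ht i
      have g0 := hu t ht 0 (by norm_num)
      rw [iteratedDeriv_zero] at g0
      have key := residual_bd (u := u t) hb hb1 hα1 hα2 hα3
        g0 (hu t ht 1 (by norm_num))
        (hu t ht 2 (by norm_num)) (hu t ht 3 (by norm_num)) (hu0 t ht)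
        (hub t ht 1 (by norm_num))
        (hub t ht 2 (by norm_num)) (hub t ht 3 (by norm_num)) (hub t ht 4 (by norm_num))
        hf1 hf2 (fun x hx => hD0 x (hmem x hx)) (fun x hx => hD1 x (hmem x hx))
        (fun x hx => hD2 x (hmem x hx))
        (fun x hx => by simpa [hf0] using hfL x (hmem x hx) 0 h0mem)
        hκ hh0 hh1 ((i : ℤ) * h) S δp.le (hout t ht)
      rw [← hI0, ← hI1, ← hI2, ← hc1, ← hc2] at key
      simp only [mul_assoc κ]
      rw [← Finset.mul_sum,
        Finset.sum_coe_sort S (fun j : ℤ => h * deriv α ((i : ℤ) * h - j * h) * f (u t (j * h))),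
        Finset.sum_coe_sort S (fun j : ℤ => h * ((deriv α ((i : ℤ) * h - (j - 1) * h) -
        2 * deriv α ((i : ℤ) * h - j * h) +
        deriv α ((i : ℤ) * h - (j + 1) * h)) / h ^ 2) * u t (j * h))]
      refine key.trans ?_
      rw [hQ]
      nlinarith [mul_nonneg c2n (sq_nonneg h), mul_nonneg c1n δp.le, sq_nonneg h])
    (by rw [← hE]; exact hsmall)
  rw [← hE] at hve
  classical
  refine ⟨N, fun t i => if hi : i ∈ S then v t ⟨i, hi⟩ else 0, ?_, ?_, ?_⟩
  · intro i hi
    rw [← hmemI] at hi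
    simp only [hi, dif_pos]
    rw [hv0]
  · intro i hi t ht
    rw [← hmemI] at hi
    rw [← hS]
    have hd := hvd t ht ⟨i, hi⟩
    simp only [mul_assoc κ] at hd
    rw [← Finset.mul_sum] at hd
    simp only [hi, dif_pos]
    convert hd using 1
    congr 1
    · congr 1
      rw [← Finset.sum_coe_sort S]
      exact Finset.sum_congr rfl fun j _ => by simp
    · congr 1
      rw [← Finset.sum_coe_sort S]
      exact Finset.sum_congr rfl fun j _ => by simp
  · intro t ht i hi
    rw [← hmemI] at hi
    simp only [hi, dif_pos]
    refine (hve t ht ⟨i, hi⟩).trans ?_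
    calc Q * (h ^ 2 + δ) * E = Q * E * (h ^ 2 + δ) := by ring
      _ ≤ Q * E * (h ^ 2 + ε) := by gcongr
end

section
/- Let a > 0, 0 < r < 1, κ > 0, T > 0, and let α : ℝ → ℝ be three times continuously differentiable off a finite set with |α′(x)| ≤ C₁·e^{−a|x|} and |α‴(x)| ≤ C₁·e^{−a|x|} for all x where the derivatives exist. Let u : [0, T] × ℝ → ℝ be bounded and continuous, differentiable in t, satisfying ∂_t u = −α′ ∗ f(u) − κ·α‴ ∗ u pointwise, where f : ℝ → ℝ is Lipschitz on [−M, M] with f(0) = 0 and M = sup |u|. If |u(0, x)| ≤ C₀·e^{−r·a|x|} for all x, then there exists C such that |u(t, x)| ≤ C·e^{−r·a|x|} for all x ∈ ℝ, t ∈ [0, T]. -/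
open MeasureTheory

lemma aux_int {c : ℝ} (hc : 0 < c) : Integrable (fun y : ℝ => Real.exp (-c * |y|)) := by
  have h1 : IntegrableOn (fun y : ℝ => Real.exp (-c * |y|)) (Set.Ioi 0) := by
    refine (exp_neg_integrableOn_Ioi 0 hc).congr_fun ?_ measurableSet_Ioi
    intro y hy
    simp only [Set.mem_Ioi] at hy
    simp [abs_of_pos hy]
  have h2 : IntegrableOn (fun y : ℝ => Real.exp (-c * |y|)) (Set.Iic 0) := by
    refine (integrableOn_exp_mul_Iic hc 0).congr_fun ?_ measurableSet_Iic
    intro y hy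
    simp only [Set.mem_Iic] at hy
    simp [abs_of_nonpos hy]
  rw [← integrableOn_univ, ← Set.Iic_union_Ioi (a := (0 : ℝ))]
  exact h2.union h1

lemma aux_conv {k h : ℝ → ℝ} {s : Finset ℝ} {a b D c m x : ℝ} (hb : 0 < b) (hab : b < a)
    (hD : 0 ≤ D) (hc : 0 ≤ c) (hm : 0 ≤ m)
    (hk : ∀ x : ℝ, x ∉ (s : Set ℝ) → |k x| ≤ D * Real.exp (-a * |x|))
    (hh : ∀ y, |h y| ≤ c * Real.exp (-b * |y|) + m) :
    |∫ y, k (x - y) * h y| ≤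
      D * (c * Real.exp (-b * |x|) + m) * ∫ y : ℝ, Real.exp (-(a - b) * |y|) := by
  have hint := aux_int (sub_pos.2 hab)
  rw [← integral_sub_left_eq_self (fun y : ℝ => Real.exp (-(a - b) * |y|)) volume x,
    ← integral_const_mul, ← Real.norm_eq_abs]
  apply norm_integral_le_of_norm_le
  · exact (hint.comp_sub_left x).const_mul _
  · have hfin : ((fun y => x - y) ⁻¹' (s : Set ℝ)).Finite :=
      s.finite_toSet.preimage (sub_right_injective.injOn)
    filter_upwards [hfin.countable.ae_notMem volume] with y hy
    have h1 := hk (x - y) hy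
    have h2 := hh y
    rw [Real.norm_eq_abs, abs_mul]
    have hw0 : 0 < Real.exp (-a * |x - y|) := Real.exp_pos _
    have tri : |x| ≤ |x - y| + |y| := by
      have := abs_add_le (x - y) y
      simpa using this
    have e1 : Real.exp (-a * |x - y|) * Real.exp (-b * |y|) ≤
        Real.exp (-b * |x|) * Real.exp (-(a - b) * |x - y|) := by
      rw [← Real.exp_add, ← Real.exp_add]
      apply Real.exp_le_exp.2
      nlinarith
    have e2 : Real.exp (-a * |x - y|) ≤ Real.exp (-(a - b) * |x - y|) := by
      apply Real.exp_le_exp.2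
      nlinarith [abs_nonneg (x - y)]
    calc |k (x - y)| * |h y|
        ≤ (D * Real.exp (-a * |x - y|)) * (c * Real.exp (-b * |y|) + m) := by gcongr
      _ = D * (c * (Real.exp (-a * |x - y|) * Real.exp (-b * |y|))
            + m * Real.exp (-a * |x - y|)) := by ring
      _ ≤ D * (c * (Real.exp (-b * |x|) * Real.exp (-(a - b) * |x - y|))
            + m * Real.exp (-(a - b) * |x - y|)) := by gcongr
      _ = _ := by ring

/-- **Exponential spatial decay of solutions** (conclusion of Example 4.5). If the kernel
derivatives satisfy `|α'(x)|, |α'''(x)| ≤ C₁ e^{−a|x|}` off a finite set, `u` is a bounded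
continuous solution of `u_t = −α' ∗ f(u) − κ α''' ∗ u` on `[0,T]` with `f` Lipschitz on
`[−M, M]`, `f(0)=0`, and `|u(0,x)| ≤ C₀ e^{−r a |x|}`, then
`|u(t,x)| ≤ C e^{−r a |x|}` on `[0,T] × ℝ`. -/
theorem exponential_decay_of_solutions
    (α : ℝ → ℝ) (a r κ T C₀ C₁ M L : ℝ) (f : ℝ → ℝ) (u : ℝ → ℝ → ℝ)
    (s : Finset ℝ)
    (ha : 0 < a) (hr0 : 0 < r) (hr1 : r < 1)
    (hα : ∀ x : ℝ, x ∉ (s : Set ℝ) → ContDiffAt ℝ 3 α x)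
    (hbound1 : ∀ x : ℝ, x ∉ (s : Set ℝ) → |deriv α x| ≤ C₁ * Real.exp (-a * |x|))
    (hbound3 : ∀ x : ℝ, x ∉ (s : Set ℝ) → |iteratedDeriv 3 α x| ≤ C₁ * Real.exp (-a * |x|))
    (hκ : 0 < κ) (hT : 0 < T)
    (hu_cont : Continuous (fun p : ℝ × ℝ => u p.1 p.2))
    (hu_bdd : ∀ t ∈ Set.Icc (0 : ℝ) T, ∀ x : ℝ, |u t x| ≤ M)
    (hf : ∀ x ∈ Set.Icc (-M) M, ∀ y ∈ Set.Icc (-M) M, |f x - f y| ≤ L * |x - y|)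
    (hf0 : f 0 = 0)
    (hueq : ∀ t ∈ Set.Icc (0 : ℝ) T, ∀ x : ℝ,
      HasDerivAt (fun s' => u s' x)
        (-(∫ y : ℝ, deriv α (x - y) * f (u t y)) -
          κ * ∫ y : ℝ, iteratedDeriv 3 α (x - y) * u t y) t)
    (hinit : ∀ x : ℝ, |u 0 x| ≤ C₀ * Real.exp (-r * a * |x|)) :
    ∃ C : ℝ, ∀ t ∈ Set.Icc (0 : ℝ) T, ∀ x : ℝ,
      |u t x| ≤ C * Real.exp (-r * a * |x|) := by
  set b := r * a with hb_def
  have hb : 0 < b := mul_pos hr0 ha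
  have hab : b < a := by nlinarith
  have hneg : -r * a = -b := by rw [hb_def]; ring
  rw [hneg] at hinit ⊢
  have hM : 0 ≤ M := (abs_nonneg _).trans (hu_bdd 0 ⟨le_rfl, hT.le⟩ 0)
  have hC0 : 0 ≤ C₀ := by
    have := (abs_nonneg _).trans (hinit 0)
    simpa using this
  set J := ∫ y : ℝ, Real.exp (-(a - b) * |y|) with hJ
  have hJ0 : 0 ≤ J := integral_nonneg fun y => (Real.exp_pos _).le
  have hk1 : ∀ x : ℝ, x ∉ (s : Set ℝ) → |deriv α x| ≤ |C₁| * Real.exp (-a * |x|) :=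
    fun x hx => (hbound1 x hx).trans (by gcongr; exact le_abs_self _)
  have hk3 : ∀ x : ℝ, x ∉ (s : Set ℝ) →
      |iteratedDeriv 3 α x| ≤ |C₁| * Real.exp (-a * |x|) :=
    fun x hx => (hbound3 x hx).trans (by gcongr; exact le_abs_self _)
  have hfu : ∀ t ∈ Set.Icc (0 : ℝ) T, ∀ x, |f (u t x)| ≤ |L| * |u t x| := by
    intro t ht x
    have := hf (u t x) (abs_le.1 (hu_bdd t ht x)) 0 ⟨by linarith, hM⟩
    rw [hf0, sub_zero, sub_zero] at this
    exact this.trans (by gcongr; exact le_abs_self _)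
  set B := |C₁| * J * (|L| + κ) with hB
  have hB0 : 0 ≤ B := by positivity
  have key : ∀ k : ℕ, ∀ t ∈ Set.Icc (0 : ℝ) T, ∀ x : ℝ,
      |u t x| ≤ C₀ * Real.exp (B * t) * Real.exp (-b * |x|) + M * ((B * t) ^ k / k.factorial) := by
    intro k
    induction k with
    | zero =>
      intro t ht x
      have := hu_bdd t ht x
      have h2 : 0 ≤ C₀ * Real.exp (B * t) * Real.exp (-b * |x|) := by positivity
      rw [pow_zero, Nat.factorial_zero, Nat.cast_one, div_one, mul_one]
      linarith
    | succ k ih =>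
      intro t ht x
      refine image_norm_le_of_norm_deriv_right_le_deriv_boundary (f := fun t => u t x)
        (f' := fun t => (-(∫ y : ℝ, deriv α (x - y) * f (u t y)) -
          κ * ∫ y : ℝ, iteratedDeriv 3 α (x - y) * u t y)) (a := 0) (b := T)
        (B := fun t => C₀ * Real.exp (B * t) * Real.exp (-b * |x|)
          + M * ((B * t) ^ (k + 1) / (k + 1).factorial))
        (B' := fun t => B * (C₀ * Real.exp (B * t) * Real.exp (-b * |x|)
          + M * ((B * t) ^ k / k.factorial)))
        ?_ ?_ ?_ ?_ ?_ ht
      · exact (hu_cont.comp (Continuous.prodMk_left x)).continuousOn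
      · intro τ hτ
        exact (hueq τ ⟨hτ.1, hτ.2.le⟩ x).hasDerivWithinAt
      · simpa using hinit x
      · intro τ
        have d0 : HasDerivAt (fun t : ℝ => B * t) B τ := by
          simpa using (hasDerivAt_id τ).const_mul B
        have d1 := ((d0.exp.const_mul C₀).mul_const (Real.exp (-b * |x|))).add
          (((d0.pow (k + 1)).div_const ((k + 1).factorial : ℝ)).const_mul M)
        refine d1.congr_deriv ?_
        rw [Nat.factorial_succ]
        have : (k.factorial : ℝ) ≠ 0 := by positivity
        have : (k : ℝ) + 1 ≠ 0 := by positivity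
        push_cast
        field_simp
      · intro τ hτ
        have hτ' : τ ∈ Set.Icc (0 : ℝ) T := ⟨hτ.1, hτ.2.le⟩
        have hτ0 : 0 ≤ τ := hτ.1
        set c := C₀ * Real.exp (B * τ) with hc
        set m := M * ((B * τ) ^ k / k.factorial) with hm
        have hc0 : 0 ≤ c := by positivity
        have hm0 : 0 ≤ m := by positivity
        have i1 := aux_conv (x := x) (h := fun y => f (u τ y)) (c := |L| * c) (m := |L| * m)
          hb hab (abs_nonneg C₁) (by positivity) (by positivity) hk1
          (fun y => (hfu τ hτ' y).trans (by
            have := mul_le_mul_of_nonneg_left (ih τ hτ' y) (abs_nonneg L)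
            linarith))
        have i2 := aux_conv (x := x) (h := fun y => u τ y) (c := c) (m := m)
          hb hab (abs_nonneg C₁) hc0 hm0 hk3 (ih τ hτ')
        rw [← hJ] at i1 i2
        have i3 := mul_le_mul_of_nonneg_left i2 hκ.le
        rw [Real.norm_eq_abs]
        refine (abs_sub _ _).trans ?_
        rw [abs_neg, abs_mul, abs_of_pos hκ]
        refine (add_le_add i1 i3).trans (le_of_eq ?_)
        rw [hB]; ring
  refine ⟨C₀ * Real.exp (B * T), fun t ht x => ?_⟩
  have hlim : Filter.Tendsto (fun k : ℕ => C₀ * Real.exp (B * t) * Real.exp (-b * |x|)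
      + M * ((B * t) ^ k / k.factorial)) Filter.atTop
      (nhds (C₀ * Real.exp (B * t) * Real.exp (-b * |x|) + M * 0)) :=
    ((FloorSemiring.tendsto_pow_div_factorial_atTop (B * t)).const_mul M).const_add _
  have := ge_of_tendsto' hlim (fun k => key k t ht x)
  rw [mul_zero, add_zero] at this
  refine this.trans ?_
  have := ht.2
  gcongr
end

section
/- Let α : ℝ → ℝ be defined by α(x) = (1/(2√2))·e^{−|x|/√2}·( cos(|x|/√2) + sin(|x|/√2) ). Then for every ξ ∈ ℝ, ∫_ℝ α(x)·cos(ξ x) dx = 1/(1 + ξ⁴). -/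
open MeasureTheory Real

lemma kernel_half_aux (s : ℝ) (hs : 0 < s) (b : ℝ) :
    IntegrableOn (fun x : ℝ => Real.exp (-s * x) * (Real.cos (b * x) + Real.sin (b * x)))
      (Set.Ioi 0) ∧
    ∫ x in Set.Ioi (0:ℝ), Real.exp (-s * x) * (Real.cos (b * x) + Real.sin (b * x))
      = (s + b) / (s ^ 2 + b ^ 2) := by
  have hre : (⟨-s, b⟩ : ℂ).re < 0 := by simpa using hs
  have hi := integrableOn_exp_mul_complex_Ioi hre 0
  have hv := integral_exp_mul_complex_Ioi hre 0
  have hir : IntegrableOn (fun x : ℝ => (Complex.exp ((⟨-s, b⟩ : ℂ) * x)).re) (Set.Ioi 0) :=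
    Integrable.re hi
  have hii : IntegrableOn (fun x : ℝ => (Complex.exp ((⟨-s, b⟩ : ℂ) * x)).im) (Set.Ioi 0) :=
    Integrable.im hi
  have e : (fun x : ℝ => Real.exp (-s * x) * (Real.cos (b * x) + Real.sin (b * x))) =
      fun x : ℝ => (Complex.exp ((⟨-s, b⟩ : ℂ) * x)).re
        + (Complex.exp ((⟨-s, b⟩ : ℂ) * x)).im := by
    funext x
    simp [Complex.exp_re, Complex.exp_im]
    ring
  rw [e]
  refine ⟨hir.add hii, ?_⟩
  rw [integral_add hir hii]
  have h1 : ∫ x in Set.Ioi (0:ℝ), (Complex.exp ((⟨-s, b⟩ : ℂ) * x)).re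
      = (∫ x in Set.Ioi (0:ℝ), Complex.exp ((⟨-s, b⟩ : ℂ) * x)).re := integral_re hi
  have h2 : ∫ x in Set.Ioi (0:ℝ), (Complex.exp ((⟨-s, b⟩ : ℂ) * x)).im
      = (∫ x in Set.Ioi (0:ℝ), Complex.exp ((⟨-s, b⟩ : ℂ) * x)).im := integral_im hi
  rw [h1, h2, hv]
  have : 0 < s ^ 2 + b ^ 2 := by positivity
  have h3 : s * s + b * b ≠ 0 := by nlinarith
  simp [Complex.div_re, Complex.div_im, Complex.normSq_apply]
  field_simp

/-- **The Rosenau–KdV kernel is the Green's function of `1 + D⁴`** (Fourier side).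
For `α(x) = (1/(2√2)) e^{−|x|/√2} (cos(|x|/√2) + sin(|x|/√2))` and every `ξ ∈ ℝ`,
`∫_ℝ α(x) cos(ξ x) dx = 1/(1 + ξ⁴)`. -/
theorem rosenau_kdv_kernel_fourier
    (α : ℝ → ℝ)
    (hα : α = fun x : ℝ =>
      (1 / (2 * Real.sqrt 2)) * Real.exp (-|x| / Real.sqrt 2) *
        (Real.cos (|x| / Real.sqrt 2) + Real.sin (|x| / Real.sqrt 2))) :
    ∀ ξ : ℝ, (∫ x : ℝ, α x * Real.cos (ξ * x)) = 1 / (1 + ξ ^ 4) := by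
  intro ξ
  obtain ⟨s, hs⟩ : ∃ s : ℝ, s = (Real.sqrt 2)⁻¹ := ⟨_, rfl⟩
  have hs0 : 0 < s := by rw [hs]; positivity
  have hs2 : s ^ 2 = 1 / 2 := by rw [hs, inv_pow, Real.sq_sqrt (by norm_num)]; norm_num
  obtain ⟨i1, v1⟩ := kernel_half_aux s hs0 (s + ξ)
  obtain ⟨i2, v2⟩ := kernel_half_aux s hs0 (s - ξ)
  have e : (fun x : ℝ => α x * Real.cos (ξ * x)) = fun x : ℝ =>
      (fun y : ℝ => (s / 4) * (Real.exp (-s * y) * (Real.cos ((s + ξ) * y) + Real.sin ((s + ξ) * y))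
        + Real.exp (-s * y) * (Real.cos ((s - ξ) * y) + Real.sin ((s - ξ) * y)))) |x| := by
    funext x
    have hc : Real.cos (ξ * x) = Real.cos (ξ * |x|) := by
      rcases abs_choice x with h | h <;> rw [h]
      rw [mul_neg, Real.cos_neg]
    have h1 : 1 / (2 * Real.sqrt 2) = s / 2 := by rw [hs]; field_simp
    have h2 : -|x| / Real.sqrt 2 = -s * |x| := by rw [hs]; field_simp
    have h3 : |x| / Real.sqrt 2 = s * |x| := by rw [hs]; field_simp
    simp only [hα]
    rw [hc, h1, h2, h3, add_mul, sub_mul, Real.cos_add, Real.sin_add, Real.cos_sub, Real.sin_sub]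
    ring
  rw [e]
  refine (integral_comp_abs (f := fun y : ℝ => (s / 4) * (Real.exp (-s * y) *
    (Real.cos ((s + ξ) * y) + Real.sin ((s + ξ) * y))
    + Real.exp (-s * y) * (Real.cos ((s - ξ) * y) + Real.sin ((s - ξ) * y))))).trans ?_
  rw [integral_const_mul, integral_add i1 i2, v1, v2]
  have d1 : s ^ 2 + (s + ξ) ^ 2 ≠ 0 := by positivity
  have d2 : s ^ 2 + (s - ξ) ^ 2 ≠ 0 := by positivity
  have d3 : 1 + ξ ^ 4 ≠ 0 := by positivity
  have d4 : (s ^ 2 + (s + ξ) ^ 2) * (s ^ 2 + (s - ξ) ^ 2) = 1 + ξ ^ 4 := by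
    linear_combination (4 * s ^ 2 + 2) * hs2
  rw [div_add_div _ _ d1 d2, d4, mul_div_assoc', mul_div_assoc']
  congr 1
  linear_combination (4 * s ^ 2 + 2) * hs2
end

section
/- Let α : ℝ → ℝ be defined by α(x) = (1/(2√3))·e^{−(√3/2)|x|}·( cos(|x|/2) + √3·sin(|x|/2) ). Then for every ξ ∈ ℝ, ∫_ℝ α(x)·cos(ξ x) dx = 1/(1 + ξ² + ξ⁴). -/
open MeasureTheory Real

lemma aux_re (s b x : ℝ) :
    (Complex.exp (((-s : ℝ) + (b : ℝ) * Complex.I) * (x : ℂ))).re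
      = Real.exp (-s * x) * Real.cos (b * x) := by
  rw [Complex.exp_re]; simp

lemma aux_im (s b x : ℝ) :
    (Complex.exp (((-s : ℝ) + (b : ℝ) * Complex.I) * (x : ℂ))).im
      = Real.exp (-s * x) * Real.sin (b * x) := by
  rw [Complex.exp_im]; simp

lemma aux_int_s16 (s b : ℝ) (hs : 0 < s) :
    IntegrableOn (fun x : ℝ => Complex.exp (((-s : ℝ) + (b : ℝ) * Complex.I) * (x : ℂ)))
      (Set.Ioi 0) :=
  integrableOn_exp_mul_complex_Ioi (by simpa using hs) 0

lemma aux_val (s b : ℝ) (hs : 0 < s) :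
    ∫ x in Set.Ioi (0 : ℝ), Complex.exp (((-s : ℝ) + (b : ℝ) * Complex.I) * (x : ℂ))
      = ((s / (s ^ 2 + b ^ 2) : ℝ) : ℂ) + ((b / (s ^ 2 + b ^ 2) : ℝ) : ℂ) * Complex.I := by
  rw [integral_exp_mul_complex_Ioi (by simpa using hs) 0]
  have h : s ^ 2 + b ^ 2 ≠ 0 := by positivity
  have h' : ((s : ℂ) ^ 2 + (b : ℂ) ^ 2) ≠ 0 := by exact_mod_cast h
  have h2 : (((-s : ℝ) : ℂ) + (b : ℝ) * Complex.I) ≠ 0 := by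
    intro h0
    have := congrArg Complex.re h0
    simp at this
    exact hs.ne' this
  rw [div_eq_iff h2]
  push_cast
  simp only [mul_zero, Complex.exp_zero]
  field_simp
  linear_combination (-(b : ℂ) ^ 2) * Complex.I_sq

lemma aux_cos_int (s b : ℝ) (hs : 0 < s) :
    IntegrableOn (fun x : ℝ => Real.exp (-s * x) * Real.cos (b * x)) (Set.Ioi 0) := by
  have := (aux_int_s16 s b hs).re
  simp only [RCLike.re_to_complex, aux_re] at this
  exact this

lemma aux_sin_int (s b : ℝ) (hs : 0 < s) :
    IntegrableOn (fun x : ℝ => Real.exp (-s * x) * Real.sin (b * x)) (Set.Ioi 0) := by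
  have := (aux_int_s16 s b hs).im
  simp only [RCLike.im_to_complex, aux_im] at this
  exact this

lemma aux_cos (s b : ℝ) (hs : 0 < s) :
    ∫ x in Set.Ioi (0 : ℝ), Real.exp (-s * x) * Real.cos (b * x) = s / (s ^ 2 + b ^ 2) := by
  have h := integral_re (aux_int_s16 s b hs)
  rw [aux_val s b hs] at h
  simp only [RCLike.re_to_complex, aux_re] at h
  rw [h, Complex.add_re, Complex.ofReal_re, Complex.re_ofReal_mul]; simp

lemma aux_sin (s b : ℝ) (hs : 0 < s) :
    ∫ x in Set.Ioi (0 : ℝ), Real.exp (-s * x) * Real.sin (b * x) = b / (s ^ 2 + b ^ 2) := by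
  have h := integral_im (aux_int_s16 s b hs)
  rw [aux_val s b hs] at h
  simp only [RCLike.im_to_complex, aux_im] at h
  rw [h, Complex.add_im, Complex.ofReal_im, Complex.im_ofReal_mul]; simp

/-- **The Rosenau–BBM–KdV kernel is the Green's function of `1 − D² + D⁴`** (Fourier side).
For `α(x) = (1/(2√3)) e^{−(√3/2)|x|} (cos(|x|/2) + √3 sin(|x|/2))` and every `ξ ∈ ℝ`,
`∫_ℝ α(x) cos(ξ x) dx = 1/(1 + ξ² + ξ⁴)`. -/
theorem rosenau_bbm_kdv_kernel_fourier
    (α : ℝ → ℝ)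
    (hα : α = fun x : ℝ =>
      (1 / (2 * Real.sqrt 3)) * Real.exp (-(Real.sqrt 3 / 2) * |x|) *
        (Real.cos (|x| / 2) + Real.sqrt 3 * Real.sin (|x| / 2))) :
    ∀ ξ : ℝ, (∫ x : ℝ, α x * Real.cos (ξ * x)) = 1 / (1 + ξ ^ 2 + ξ ^ 4) := by
  intro ξ
  have hs3 : Real.sqrt 3 ^ 2 = 3 := Real.sq_sqrt (by norm_num)
  have hpos : 0 < Real.sqrt 3 := Real.sqrt_pos.mpr (by norm_num)
  have hs : 0 < Real.sqrt 3 / 2 := by positivity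
  set r := Real.sqrt 3 with hr
  have e1 : (fun x : ℝ => α x * Real.cos (ξ * x)) = fun x => (fun y : ℝ =>
      (1 / (4 * r)) * (Real.exp (-(r / 2) * y) * Real.cos ((1 / 2 + ξ) * y)
        + Real.exp (-(r / 2) * y) * Real.cos ((1 / 2 - ξ) * y)
        + r * (Real.exp (-(r / 2) * y) * Real.sin ((1 / 2 + ξ) * y))
        + r * (Real.exp (-(r / 2) * y) * Real.sin ((1 / 2 - ξ) * y)))) |x| := by
    funext x
    have hc : Real.cos (ξ * x) = Real.cos (ξ * |x|) := by
      rcases abs_choice x with h | h <;> rw [h]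
      rw [mul_neg, Real.cos_neg]
    rw [hα, hc]
    have a1 : (1 / 2 + ξ) * |x| = |x| / 2 + ξ * |x| := by ring
    have a2 : (1 / 2 - ξ) * |x| = |x| / 2 - ξ * |x| := by ring
    simp only [a1, a2, Real.cos_add, Real.cos_sub, Real.sin_add, Real.sin_sub]
    field_simp
    ring
  rw [e1]
  refine (integral_comp_abs (f := fun y : ℝ =>
      (1 / (4 * r)) * (Real.exp (-(r / 2) * y) * Real.cos ((1 / 2 + ξ) * y)
        + Real.exp (-(r / 2) * y) * Real.cos ((1 / 2 - ξ) * y)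
        + r * (Real.exp (-(r / 2) * y) * Real.sin ((1 / 2 + ξ) * y))
        + r * (Real.exp (-(r / 2) * y) * Real.sin ((1 / 2 - ξ) * y))))).trans ?_
  rw [integral_const_mul]
  have i1 := aux_cos_int (r / 2) (1 / 2 + ξ) hs
  have i2 := aux_cos_int (r / 2) (1 / 2 - ξ) hs
  have i3 := (aux_sin_int (r / 2) (1 / 2 + ξ) hs).const_mul r
  have i4 := (aux_sin_int (r / 2) (1 / 2 - ξ) hs).const_mul r
  rw [integral_add (by exact (i1.add i2).add i3) i4, integral_add (by exact i1.add i2) i3,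
    integral_add i1 i2,
    integral_const_mul, integral_const_mul, aux_cos _ _ hs, aux_cos _ _ hs, aux_sin _ _ hs,
    aux_sin _ _ hs]
  have d1 : (r / 2) ^ 2 + (1 / 2 + ξ) ^ 2 = 1 + ξ + ξ ^ 2 := by linear_combination hs3 / 4
  have d2 : (r / 2) ^ 2 + (1 / 2 - ξ) ^ 2 = 1 - ξ + ξ ^ 2 := by linear_combination hs3 / 4
  rw [d1, d2]
  have p1 : 1 + ξ + ξ ^ 2 ≠ 0 := by nlinarith [sq_nonneg (1 / 2 + ξ)]
  have p2 : 1 - ξ + ξ ^ 2 ≠ 0 := by nlinarith [sq_nonneg (1 / 2 - ξ)]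
  have p3 : 1 + ξ ^ 2 + ξ ^ 4 ≠ 0 := by positivity
  field_simp
  ring
end

section
/- Set A = −35/24 + (35/312)·√313, B = (1/24)·√(−26 + 2√313), and c = 1/2 + (1/26)·√313, and define u : ℝ × ℝ → ℝ by u(x, t) = A·sech⁴( B·(x − c·t) ). Then u satisfies the Rosenau–KdV equation with quadratic nonlinearity and κ = 1: for all (x, t), ∂_t u + ∂_x u + ∂_x⁴ ∂_t u + ∂_x³ u + u·∂_x u = 0. -/
open Real

lemma rk_hS (z : ℝ) : HasDerivAt (fun z => 1 / Real.cosh z)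
    (-((1 / Real.cosh z) * Real.tanh z)) z := by
  have h := (Real.hasDerivAt_cosh z).inv (Real.cosh_pos z).ne'
  have h0 := (Real.cosh_pos z).ne'
  simp only [one_div]
  refine h.congr_deriv ?_
  rw [Real.tanh_eq_sinh_div_cosh]
  field_simp

lemma rk_hT (z : ℝ) : HasDerivAt Real.tanh ((1 / Real.cosh z) ^ 2) z := by
  have h0 := (Real.cosh_pos z).ne'
  have h := (Real.hasDerivAt_sinh z).div (Real.hasDerivAt_cosh z) h0
  have e : Real.tanh = Real.sinh / Real.cosh := by
    funext w; simp [Real.tanh_eq_sinh_div_cosh]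
  rw [e]
  refine h.congr_deriv ?_
  have := Real.cosh_sq z
  field_simp
  linarith

lemma rk_TS (z : ℝ) : Real.tanh z ^ 2 = 1 - (1 / Real.cosh z) ^ 2 := by
  have h0 := (Real.cosh_pos z).ne'
  have := Real.cosh_sq z
  rw [Real.tanh_eq_sinh_div_cosh]
  field_simp
  linarith

/-- Even polynomial profile in sech. -/
lemma rk_even (a b d B e x : ℝ) :
    deriv (fun y => a * (1 / Real.cosh (B * (y - e))) ^ 4 + b * (1 / Real.cosh (B * (y - e))) ^ 6
      + d * (1 / Real.cosh (B * (y - e))) ^ 8) x =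
    B * (Real.tanh (B * (x - e)) * (-4 * a * (1 / Real.cosh (B * (x - e))) ^ 4
      - 6 * b * (1 / Real.cosh (B * (x - e))) ^ 6 - 8 * d * (1 / Real.cosh (B * (x - e))) ^ 8)) := by
  have hl : HasDerivAt (fun y => B * (y - e)) B x := by
    simpa using ((hasDerivAt_id x).sub_const e).const_mul B
  have hs : HasDerivAt (fun y => 1 / Real.cosh (B * (y - e))) _ x :=
    HasDerivAt.comp (h₂ := fun z => 1 / Real.cosh z) x (rk_hS (B * (x - e))) hl
  refine ((((hs.pow 4).const_mul a).add ((hs.pow 6).const_mul b)).add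
    ((hs.pow 8).const_mul d)).deriv.trans ?_
  push_cast
  ring

lemma rk_odd (a b B e x : ℝ) :
    deriv (fun y => Real.tanh (B * (y - e)) * (a * (1 / Real.cosh (B * (y - e))) ^ 4
      + b * (1 / Real.cosh (B * (y - e))) ^ 6)) x =
    B * (-4 * a * (1 / Real.cosh (B * (x - e))) ^ 4
      + (5 * a - 6 * b) * (1 / Real.cosh (B * (x - e))) ^ 6
      + 7 * b * (1 / Real.cosh (B * (x - e))) ^ 8) := by
  have hl : HasDerivAt (fun y => B * (y - e)) B x := by
    simpa using ((hasDerivAt_id x).sub_const e).const_mul B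
  have hs : HasDerivAt (fun y => 1 / Real.cosh (B * (y - e))) _ x :=
    HasDerivAt.comp (h₂ := fun z => 1 / Real.cosh z) x (rk_hS (B * (x - e))) hl
  have ht : HasDerivAt (fun y => Real.tanh (B * (y - e))) _ x :=
    HasDerivAt.comp (h₂ := Real.tanh) x (rk_hT (B * (x - e))) hl
  refine (ht.mul (((hs.pow 4).const_mul a).add ((hs.pow 6).const_mul b))).deriv.trans ?_
  have hTS := rk_TS (B * (x - e))
  simp only [Pi.add_apply, Pi.pow_apply, Pi.mul_apply]
  push_cast
  generalize 1 / Real.cosh (B * (x - e)) = S at *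
  generalize Real.tanh (B * (x - e)) = T at *
  linear_combination (-4 * a * B * S ^ 4 - 6 * b * B * S ^ 6) * hTS

/-- The first four space derivatives of `a sech^4`. -/
lemma rk_d1 (a B e : ℝ) : deriv (fun y => a * (1 / Real.cosh (B * (y - e))) ^ 4) =
    fun x => Real.tanh (B * (x - e)) * ((-4 * a * B) * (1 / Real.cosh (B * (x - e))) ^ 4
      + 0 * (1 / Real.cosh (B * (x - e))) ^ 6) := by
  funext x
  have := rk_even a 0 0 B e x
  simp only [zero_mul, add_zero] at this
  rw [this]; ring

lemma rk_d2 (a b B e : ℝ) :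
    deriv (fun y => Real.tanh (B * (y - e)) * (a * (1 / Real.cosh (B * (y - e))) ^ 4
      + b * (1 / Real.cosh (B * (y - e))) ^ 6)) =
    fun x => (B * (-4 * a)) * (1 / Real.cosh (B * (x - e))) ^ 4
      + (B * (5 * a - 6 * b)) * (1 / Real.cosh (B * (x - e))) ^ 6
      + (B * (7 * b)) * (1 / Real.cosh (B * (x - e))) ^ 8 := by
  funext x
  rw [rk_odd]; ring

lemma rk_time (A B c y t : ℝ) :
    deriv (fun s => A * (1 / Real.cosh (B * (y - c * s))) ^ 4) t =
    Real.tanh (B * (y - c * t)) * ((4 * A * B * c) * (1 / Real.cosh (B * (y - c * t))) ^ 4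
      + 0 * (1 / Real.cosh (B * (y - c * t))) ^ 6) := by
  have hl : HasDerivAt (fun s => B * (y - c * s)) (B * (-c)) t := by
    simpa using (((hasDerivAt_id t).const_mul c).const_sub y).const_mul B
  have hs : HasDerivAt (fun s => 1 / Real.cosh (B * (y - c * s))) _ t :=
    HasDerivAt.comp (h₂ := fun z => 1 / Real.cosh z) t (rk_hS (B * (y - c * t))) hl
  refine ((hs.pow 4).const_mul A).deriv.trans ?_
  push_cast
  ring

/-- **Exact solitary wave of the Rosenau–KdV equation** ((5.1)–(5.2) of the paper).
With `A = −35/24 + (35/312)√313`, `B = (1/24)√(−26 + 2√313)`, `c = 1/2 + (1/26)√313`,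
the function `u(x,t) = A sech⁴(B(x − ct))` satisfies
`u_t + u_x + u_{xxxxt} + u_{xxx} + u u_x = 0`. -/
theorem rosenau_kdv_solitary_wave
    (A B c : ℝ) (u : ℝ → ℝ → ℝ)
    (hA : A = -35 / 24 + (35 / 312) * Real.sqrt 313)
    (hB : B = (1 / 24) * Real.sqrt (-26 + 2 * Real.sqrt 313))
    (hc : c = 1 / 2 + (1 / 26) * Real.sqrt 313)
    (hu : u = fun x t => A * (1 / Real.cosh (B * (x - c * t))) ^ 4) :
    ∀ x t : ℝ,
      deriv (fun s => u x s) t +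
      deriv (fun y => u y t) x +
      iteratedDeriv 4 (fun y => deriv (fun s => u y s) t) x +
      iteratedDeriv 3 (fun y => u y t) x +
      u x t * deriv (fun y => u y t) x = 0 := by
  intro x t
  have hr : Real.sqrt 313 ^ 2 = 313 := Real.sq_sqrt (by norm_num)
  have hr13 : 13 ≤ Real.sqrt 313 := Real.le_sqrt_of_sq_le (by norm_num)
  have hB2 : B ^ 2 = (Real.sqrt 313 - 13) / 288 := by
    rw [hB, mul_pow, Real.sq_sqrt (by linarith)]; ring
  have hcB : c * B ^ 2 = 1 / 52 := by
    rw [hB2, hc]; linear_combination (1 / 7488) * hr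
  have hAB : A = 420 / 13 * B ^ 2 := by rw [hA, hB2]; ring
  have hcc : 1 - c + 144 / 13 * B ^ 2 = 0 := by rw [hc, hB2]; ring
  have h8 : ∀ a b B e : ℝ, deriv (fun y => a * (1 / Real.cosh (B * (y - e))) ^ 4
      + b * (1 / Real.cosh (B * (y - e))) ^ 6 + (B * (7 * 0)) * (1 / Real.cosh (B * (y - e))) ^ 8) =
      fun x => Real.tanh (B * (x - e)) * ((-4 * a * B) * (1 / Real.cosh (B * (x - e))) ^ 4
      + (-6 * b * B) * (1 / Real.cosh (B * (x - e))) ^ 6) := by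
    intro a b B e; funext x; rw [rk_even]; ring
  subst hu
  simp only [rk_time, iteratedDeriv_succ', iteratedDeriv_zero, rk_d1, rk_d2, h8, rk_even]
  generalize 1 / Real.cosh (B * (x - c * t)) = S
  generalize Real.tanh (B * (x - c * t)) = T
  clear hA hB hc hB2 hr hr13 h8

  linear_combination (T * A * B) * (-4 * S ^ 4 * hcc + B ^ 2 * (1024 * S ^ 4 - 6240 * S ^ 6 + 6720 * S ^ 8) * hcB - 4 * S ^ 8 * hAB)
end

section
/- Set A = (5/456)·(−25 + 13·√457), B = (1/√288)·√(−13 + √457), and c = (241 + 13·√457)/266, and define u : ℝ × ℝ → ℝ by u(x, t) = A·sech⁴( B·(x − c·t) ). Then u satisfies the Rosenau–BBM–KdV equation with quadratic nonlinearity and κ = 1: for all (x, t), ∂_t u + ∂_x u − ∂_x² ∂_t u + ∂_x⁴ ∂_t u + ∂_x³ u + u·∂_x u = 0. -/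
open Real

lemma hasS (B d : ℝ) (n : ℕ) (y : ℝ) :
    HasDerivAt (fun y => (1 / Real.cosh (B * (y - d))) ^ (n + 1))
      (-(n + 1) * B * (Real.sinh (B * (y - d)) * (1 / Real.cosh (B * (y - d))) ^ (n + 2))) y := by
  have h0 : HasDerivAt (fun y : ℝ => B * (y - d)) B y := by
    simpa using ((hasDerivAt_id y).sub_const d).const_mul B
  have hne := (Real.cosh_pos (B * (y - d))).ne'
  have h1 := (h0.cosh.inv hne).pow (n + 1)
  simp only [one_div]
  refine h1.congr_deriv ?_
  simp only [Pi.inv_apply, Nat.add_sub_cancel]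
  push_cast
  simp only [inv_pow, pow_add]
  field_simp

lemma hasG (B d : ℝ) (n : ℕ) (y : ℝ) :
    HasDerivAt (fun y => Real.sinh (B * (y - d)) * (1 / Real.cosh (B * (y - d))) ^ (n + 1))
      (B * (-n * (1 / Real.cosh (B * (y - d))) ^ n
        + (n + 1) * (1 / Real.cosh (B * (y - d))) ^ (n + 2))) y := by
  have h0 : HasDerivAt (fun y : ℝ => B * (y - d)) B y := by
    simpa using ((hasDerivAt_id y).sub_const d).const_mul B
  have hne := (Real.cosh_pos (B * (y - d))).ne'
  refine (h0.sinh.mul (hasS B d n y)).congr_deriv ?_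
  have hs := Real.sinh_sq (B * (y - d))
  simp only [one_div, inv_pow, pow_add]
  field_simp
  rw [hs]
  ring

/-- second derivative -/
lemma ddG (B d p q : ℝ) :
    deriv (deriv (fun y => Real.sinh (B * (y - d)) * (p * (1 / Real.cosh (B * (y - d))) ^ 5
      + q * (1 / Real.cosh (B * (y - d))) ^ 7))) =
    fun y => Real.sinh (B * (y - d)) * (B ^ 2 * 16 * p * (1 / Real.cosh (B * (y - d))) ^ 5
      + B ^ 2 * (36 * q - 30 * p) * (1 / Real.cosh (B * (y - d))) ^ 7
      - B ^ 2 * 56 * q * (1 / Real.cosh (B * (y - d))) ^ 9) := by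
  have h1 : deriv (fun y => Real.sinh (B * (y - d)) * (p * (1 / Real.cosh (B * (y - d))) ^ 5
      + q * (1 / Real.cosh (B * (y - d))) ^ 7)) = fun y =>
      -4 * B * p * (1 / Real.cosh (B * (y - d))) ^ 4
      + (5 * B * p - 6 * B * q) * (1 / Real.cosh (B * (y - d))) ^ 6
      + 7 * B * q * (1 / Real.cosh (B * (y - d))) ^ 8 := by
    funext y
    have h := ((hasG B d 4 y).const_mul p).add ((hasG B d 6 y).const_mul q)
    convert h.deriv using 1
    · congr 1
      funext z
      simp only [Pi.add_apply]
      ring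
    · push_cast
      ring
  rw [h1]
  funext y
  have h := (((hasS B d 3 y).const_mul (-4 * B * p)).add
    ((hasS B d 5 y).const_mul (5 * B * p - 6 * B * q))).add ((hasS B d 7 y).const_mul (7 * B * q))
  refine Eq.trans h.deriv ?_
  push_cast
  ring

/-- **Exact solitary wave of the Rosenau–BBM–KdV equation** ((5.1) with (5.5) of the paper).
With `A = (5/456)(−25 + 13√457)`, `B = (1/√288)√(−13 + √457)`, `c = (241 + 13√457)/266`,
the function `u(x,t) = A sech⁴(B(x − ct))` satisfies
`u_t + u_x − u_{xxt} + u_{xxxxt} + u_{xxx} + u u_x = 0`. -/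
theorem rosenau_bbm_kdv_solitary_wave
    (A B c : ℝ) (u : ℝ → ℝ → ℝ)
    (hA : A = (5 / 456) * (-25 + 13 * Real.sqrt 457))
    (hB : B = (1 / Real.sqrt 288) * Real.sqrt (-13 + Real.sqrt 457))
    (hc : c = (241 + 13 * Real.sqrt 457) / 266)
    (hu : u = fun x t => A * (1 / Real.cosh (B * (x - c * t))) ^ 4) :
    ∀ x t : ℝ,
      deriv (fun s => u x s) t +
      deriv (fun y => u y t) x -
      iteratedDeriv 2 (fun y => deriv (fun s => u y s) t) x +
      iteratedDeriv 4 (fun y => deriv (fun s => u y s) t) x +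
      iteratedDeriv 3 (fun y => u y t) x +
      u x t * deriv (fun y => u y t) x = 0 := by
  intro x t
  have hs : Real.sqrt 457 ^ 2 = 457 := Real.sq_sqrt (by norm_num)
  have hs13 : (13 : ℝ) ≤ Real.sqrt 457 := Real.le_sqrt_of_sq_le (by norm_num)
  have hb : B ^ 2 = (Real.sqrt 457 - 13) / 288 := by
    rw [hB, mul_pow, div_pow, Real.sq_sqrt (by norm_num), Real.sq_sqrt (by linarith)]
    ring
  have hx : ∀ t, deriv (fun y => u y t) = fun y => Real.sinh (B * (y - c * t)) *
      ((-4 * A * B) * (1 / Real.cosh (B * (y - c * t))) ^ 5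
      + 0 * (1 / Real.cosh (B * (y - c * t))) ^ 7) := by
    intro t
    funext y
    rw [hu]
    refine ((hasS B (c * t) 3 y).const_mul A).deriv.trans ?_
    push_cast
    ring
  have ht : (fun y => deriv (fun s => u y s) t) = fun y => Real.sinh (B * (y - c * t)) *
      ((4 * c * A * B) * (1 / Real.cosh (B * (y - c * t))) ^ 5
      + 0 * (1 / Real.cosh (B * (y - c * t))) ^ 7) := by
    funext y
    rw [hu]
    have h0 : HasDerivAt (fun s : ℝ => y - c * s) (-c) t := by
      simpa using ((hasDerivAt_id t).const_mul c).const_sub y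
    have h := HasDerivAt.comp t (hasS B 0 3 (y - c * t)) h0
    have h2 := (h.const_mul A).deriv
    simp only [Function.comp_def, sub_zero] at h2
    refine h2.trans ?_
    push_cast
    ring
  have ht0 := congrFun ht x
  have e2 : ∀ f : ℝ → ℝ, iteratedDeriv 2 f = deriv (deriv f) := by
    intro f; simp [iteratedDeriv_succ, iteratedDeriv_zero]
  have e3 : ∀ f : ℝ → ℝ, iteratedDeriv 3 f = deriv (deriv (deriv f)) := by
    intro f; simp [iteratedDeriv_succ, iteratedDeriv_zero]
  have e4 : ∀ f : ℝ → ℝ, iteratedDeriv 4 f = deriv (deriv (deriv (deriv f))) := by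
    intro f; simp [iteratedDeriv_succ, iteratedDeriv_zero]
  have hz : (fun y => Real.sinh (B * (y - c * t)) *
      (B ^ 2 * 16 * (4 * c * A * B) * (1 / Real.cosh (B * (y - c * t))) ^ 5
      + B ^ 2 * (36 * 0 - 30 * (4 * c * A * B)) * (1 / Real.cosh (B * (y - c * t))) ^ 7
      - B ^ 2 * 56 * 0 * (1 / Real.cosh (B * (y - c * t))) ^ 9)) =
      fun y => Real.sinh (B * (y - c * t)) *
      ((B ^ 2 * 16 * (4 * c * A * B)) * (1 / Real.cosh (B * (y - c * t))) ^ 5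
      + (B ^ 2 * (36 * 0 - 30 * (4 * c * A * B))) * (1 / Real.cosh (B * (y - c * t))) ^ 7) := by
    funext y; ring
  rw [ht0, e2, e3, e4, ht, hx t, ddG, ddG, hz, ddG]
  have hux : u x t = A * (1 / Real.cosh (B * (x - c * t))) ^ 4 := by rw [hu]
  rw [hux]
  beta_reduce
  generalize 1 / Real.cosh (B * (x - c * t)) = S
  generalize Real.sinh (B * (x - c * t)) = T
  have k1 : 1 - c + 16 * (1 + c) * B ^ 2 - 256 * c * (B ^ 2) ^ 2 = 0 := by
    rw [hb, hc]
    generalize Real.sqrt 457 = s at hs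
    have h3 : s ^ 3 = 457 * s := by rw [pow_succ, hs]
    ring_nf
    simp only [hs, h3]
    ring
  have k2 : -30 * (1 + c) * B ^ 2 + 1560 * c * (B ^ 2) ^ 2 = 0 := by
    rw [hb, hc]
    generalize Real.sqrt 457 = s at hs
    have h3 : s ^ 3 = 457 * s := by rw [pow_succ, hs]
    ring_nf
    simp only [hs, h3]
    ring
  have k3 : A - 1680 * c * (B ^ 2) ^ 2 = 0 := by
    rw [hb, hc, hA]
    generalize Real.sqrt 457 = s at hs
    have h3 : s ^ 3 = 457 * s := by rw [pow_succ, hs]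
    ring_nf
    simp only [hs, h3]
    ring
  linear_combination (-4 * A * B * T) * (S ^ 5 * k1 + S ^ 7 * k2 + S ^ 9 * k3)
end
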